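/- There exists a constant D = D(α) > 0 (depending only on α and on the map, the invariant density, and the constants in the assumed correlation-decay estimate) such that for every integer n ≥ 1 and every componentwise Lipschitz function K : [0,1]^n → ℝ, ∫ ( K(x, Tx, …, T^{n−1}x) − ∫ K(y, Ty, …, T^{n−1}y) dμ(y) )² dμ(x) ≤ D · Σ_{j=1}^n Lip_j(K)². -/

import Mathlib

open MeasureTheory Set

namespace VarIneq

lemma theta_bound (c α : ℝ) (hc : 0 < c) (hα : 0 < α) (h7 : 7 * α ≤ 1) :
    ∃ B : ℝ, 1 ≤ B ∧ ∀ (s t : ℝ) (m : ℕ), 0 ≤ t → t + c * t ^ (1 + α) ≤ s →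
      s ≤ B / ((m : ℝ) + 1) ^ 7 → t ≤ B / ((m : ℝ) + 2) ^ 7 := by
  refine ⟨max 1 ((254 / c) ^ (1 / α)), le_max_left _ _, ?_⟩
  set B := max 1 ((254 / c) ^ (1 / α)) with hB
  have hB1 : 1 ≤ B := le_max_left _ _
  have hB2 : 254 ≤ c * B ^ α := by
    have h1 : ((254 / c) ^ (1 / α)) ^ α ≤ B ^ α :=
      Real.rpow_le_rpow (by positivity) (le_max_right _ _) hα.le
    rw [← Real.rpow_mul (by positivity), one_div, inv_mul_cancel₀ hα.ne', Real.rpow_one] at h1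
    calc (254 : ℝ) = c * (254 / c) := by field_simp
      _ ≤ _ := by gcongr
  intro s t m ht hts hs
  by_contra! hlt
  have hm : (0 : ℝ) ≤ m := Nat.cast_nonneg m
  set b := B / ((m : ℝ) + 2) ^ 7 with hb
  have hbpos : 0 < b := by positivity
  have hbα : B ^ α / ((m : ℝ) + 2) ≤ b ^ α := by
    rw [hb, Real.div_rpow (by positivity) (by positivity)]
    apply div_le_div_of_nonneg_left (by positivity) (by positivity)
    rw [← Real.rpow_natCast, ← Real.rpow_mul (by positivity)]
    calc ((m : ℝ) + 2) ^ (((7 : ℕ) : ℝ) * α) ≤ ((m : ℝ) + 2) ^ (1 : ℝ) :=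
          Real.rpow_le_rpow_of_exponent_le (by linarith) (by push_cast; exact h7)
      _ = _ := Real.rpow_one _
  have h1 : b * (1 + 254 / ((m : ℝ) + 2)) ≤ b + c * b ^ (1 + α) := by
    rw [Real.rpow_add hbpos, Real.rpow_one]
    have : 254 / ((m : ℝ) + 2) ≤ c * b ^ α := by
      calc 254 / ((m : ℝ) + 2) ≤ (c * B ^ α) / ((m : ℝ) + 2) := by gcongr
        _ = c * (B ^ α / ((m : ℝ) + 2)) := by ring
        _ ≤ _ := by gcongr
    nlinarith
  have h2 : b + c * b ^ (1 + α) < t + c * t ^ (1 + α) := by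
    have : b ^ (1 + α) ≤ t ^ (1 + α) := Real.rpow_le_rpow hbpos.le hlt.le (by linarith)
    nlinarith
  have h3 : B / ((m : ℝ) + 1) ^ 7 ≤ b * (1 + 254 / ((m : ℝ) + 2)) := by
    rw [hb]
    rw [div_mul_eq_mul_div, div_le_div_iff₀ (by positivity) (by positivity)]
    have : ((m : ℝ) + 2) ^ 7 ≤ (1 + 254 / ((m : ℝ) + 2)) * ((m : ℝ) + 1) ^ 7 := by
      have h4 : 1 + 254 / ((m : ℝ) + 2) = ((m : ℝ) + 256) / ((m : ℝ) + 2) := by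
        field_simp; ring
      rw [h4, div_mul_eq_mul_div, le_div_iff₀ (by positivity)]
      rw [← sub_nonneg]
      ring_nf
      positivity
    nlinarith
  linarith

/-- `a` and `b` lie on the same side of `1/2` -/
def SameSide (a b : ℝ) : Prop := (a < 1 / 2 ↔ b < 1 / 2)

lemma contraction (α c : ℝ) (T : ℝ → ℝ) (hT : MapsTo T (Icc (0:ℝ) 1) (Icc (0:ℝ) 1))
    (hexp : ∀ x ∈ Icc (0:ℝ) 1, ∀ y ∈ Icc (0:ℝ) 1, SameSide x y →
      |x - y| + c * |x - y| ^ (1 + α) ≤ |T x - T y|)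
    (B : ℝ) (hB : 1 ≤ B)
    (hstep : ∀ (s t : ℝ) (m : ℕ), 0 ≤ t → t + c * t ^ (1 + α) ≤ s →
      s ≤ B / ((m : ℝ) + 1) ^ 7 → t ≤ B / ((m : ℝ) + 2) ^ 7) :
    ∀ (J : ℕ), ∀ x ∈ Icc (0:ℝ) 1, ∀ y ∈ Icc (0:ℝ) 1,
      (∀ i < J, SameSide (T^[i] x) (T^[i] y)) → |x - y| ≤ B / ((J : ℝ) + 1) ^ 7 := by
  intro J
  induction J with
  | zero =>
    intro x hx y hy _
    simp only [Nat.cast_zero, zero_add, one_pow, div_one]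
    rw [abs_le]; constructor <;> linarith [hx.1, hx.2, hy.1, hy.2]
  | succ J ih =>
    intro x hx y hy hs
    have h1 := ih (T x) (hT hx) (T y) (hT hy) (fun i hi => by
      have := hs (i + 1) (by omega)
      simpa [Function.iterate_succ_apply] using this)
    have h2 := hexp x hx y hy (by simpa using hs 0 (by omega))
    have := hstep _ _ J (abs_nonneg _) h2 h1
    push_cast
    convert this using 3
    ring

lemma contraction_iter (T : ℝ → ℝ) (hT : MapsTo T (Icc (0:ℝ) 1) (Icc (0:ℝ) 1)) (B : ℝ)
    (h : ∀ (J : ℕ), ∀ x ∈ Icc (0:ℝ) 1, ∀ y ∈ Icc (0:ℝ) 1,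
      (∀ i < J, SameSide (T^[i] x) (T^[i] y)) → |x - y| ≤ B / ((J : ℝ) + 1) ^ 7) :
    ∀ (J i : ℕ), i ≤ J → ∀ x ∈ Icc (0:ℝ) 1, ∀ y ∈ Icc (0:ℝ) 1,
      (∀ i < J, SameSide (T^[i] x) (T^[i] y)) →
      |T^[i] x - T^[i] y| ≤ B / (((J - i : ℕ) : ℝ) + 1) ^ 7 := by
  intro J i hi x hx y hy hs
  apply h _ _ (hT.iterate i hx) _ (hT.iterate i hy)
  intro r hr
  rw [← Function.iterate_add_apply, ← Function.iterate_add_apply]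
  exact hs _ (by omega)

end VarIneq

open MeasureTheory Set

namespace VarIneq

lemma right_branch (T T' : ℝ → ℝ)
    (hT_deriv : ∀ x ∈ Icc (1/2:ℝ) 1, HasDerivWithinAt T (T' x) (Icc (1/2:ℝ) 1) x)
    (hT_C2 : ContDiffOn ℝ 2 T (Icc (1/2:ℝ) 1))
    (hT_expanding : ∀ x ∈ Icc (1/2:ℝ) 1, 1 < |T' x|) :
    ∃ lam C2 : ℝ, 1 < lam ∧ 0 ≤ C2 ∧
      (∀ x ∈ Icc (1/2:ℝ) 1, ∀ y ∈ Icc (1/2:ℝ) 1, lam * |x - y| ≤ |T x - T y|) ∧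
      (∀ x ∈ Icc (1/2:ℝ) 1, ∀ y ∈ Icc (1/2:ℝ) 1,
        |Real.log (|T' x|) - Real.log (|T' y|)| ≤ C2 * |x - y|) := by
  have hu : UniqueDiffOn ℝ (Icc (1/2:ℝ) 1) := uniqueDiffOn_Icc (by norm_num)
  have hd : ContDiffOn ℝ 1 (derivWithin T (Icc (1/2:ℝ) 1)) (Icc (1/2:ℝ) 1) :=
    hT_C2.derivWithin hu (by norm_num)
  have hd' : ContDiffOn ℝ 1 T' (Icc (1/2:ℝ) 1) :=
    hd.congr (fun x hx => ((hT_deriv x hx).derivWithin (hu x hx)).symm)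
  obtain ⟨L, hL⟩ := hd'.exists_lipschitzOnWith (by norm_num) (convex_Icc _ _) isCompact_Icc
  obtain ⟨x0, hx0, hmin⟩ := (isCompact_Icc (a := (1/2:ℝ)) (b := 1)).exists_isMinOn
    ⟨1, by norm_num⟩ (hd'.continuousOn.abs)
  have hTc : ContinuousOn T (Icc (1/2:ℝ) 1) := hT_C2.continuousOn
  refine ⟨|T' x0|, L, hT_expanding x0 hx0, L.2, ?_, ?_⟩
  · have key : ∀ x ∈ Icc (1/2:ℝ) 1, ∀ y ∈ Icc (1/2:ℝ) 1, x < y →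
        |T' x0| * |x - y| ≤ |T x - T y| := by
      intro x hx y hy hxy
      have hsub : Icc x y ⊆ Icc (1/2:ℝ) 1 := Icc_subset_Icc hx.1 hy.2
      obtain ⟨c, hc, hce⟩ := exists_hasDerivAt_eq_slope T T' hxy (hTc.mono hsub)
        (fun z hz => (hT_deriv z (hsub (Ioo_subset_Icc_self hz))).hasDerivAt
          (Icc_mem_nhds (lt_of_le_of_lt hx.1 hz.1) (lt_of_lt_of_le hz.2 hy.2)))
      have h1 : T y - T x = T' c * (y - x) := by
        rw [hce]; field_simp [sub_ne_zero.2 hxy.ne']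
      rw [abs_sub_comm (T x), h1, abs_mul, abs_sub_comm x y]
      exact mul_le_mul_of_nonneg_right (hmin (hsub (Ioo_subset_Icc_self hc))) (abs_nonneg _)
    intro x hx y hy
    rcases lt_trichotomy x y with h | h | h
    · exact key x hx y hy h
    · simp [h]
    · rw [abs_sub_comm, abs_sub_comm (T x)]; exact key y hy x hx h
  · have key : ∀ x ∈ Icc (1/2:ℝ) 1, ∀ y ∈ Icc (1/2:ℝ) 1,
        Real.log (|T' x|) - Real.log (|T' y|) ≤ L * |x - y| := by
      intro x hx y hy
      have h1 := hT_expanding x hx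
      have h2 := hT_expanding y hy
      rw [← Real.log_div (by linarith) (by linarith)]
      have h3 := Real.log_le_sub_one_of_pos (x := |T' x| / |T' y|) (by positivity)
      have h4 := hL.dist_le_mul x hx y hy
      rw [Real.dist_eq, Real.dist_eq] at h4
      have h5 : |T' x| / |T' y| - 1 ≤ |T' x - T' y| := by
        have h6 : |T' x| - |T' y| ≤ |T' x - T' y| := abs_sub_abs_le_abs_sub _ _
        rw [div_sub_one (by linarith), div_le_iff₀ (by linarith)]
        nlinarith [abs_nonneg (T' x - T' y)]
      linarith
    intro x hx y hy
    rw [abs_le]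
    constructor
    · have := key y hy x hx
      rw [abs_sub_comm] at this; linarith
    · exact key x hx y hy

/-- formula of the left branch -/
noncomputable def TL (α y : ℝ) : ℝ := y + (2:ℝ) ^ α * y ^ (1 + α)

/-- derivative of the left branch -/
noncomputable def TL' (α y : ℝ) : ℝ := 1 + (1 + α) * (2 * y) ^ α

lemma TL_hasDeriv (α : ℝ) (hα : 0 < α) (y : ℝ) (hy : 0 < y) : HasDerivAt (TL α) (TL' α y) y := by
  unfold TL TL'
  have h1 := (hasDerivAt_id y).add
    ((Real.hasDerivAt_rpow_const (p := 1 + α) (Or.inl hy.ne')).const_mul ((2:ℝ) ^ α))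
  refine h1.congr_deriv ?_
  rw [Real.mul_rpow (by norm_num) hy.le]
  rw [show 1 + α - 1 = α by ring]
  ring

lemma TL_eq (α : ℝ) (hα : 0 < α) (y : ℝ) (hy : 0 < y) : TL α y = y * (1 + (2 * y) ^ α) := by
  unfold TL
  rw [Real.rpow_add hy, Real.rpow_one, Real.mul_rpow (by norm_num) hy.le]; ring

lemma TL_expand (α : ℝ) (hα : 0 < α) (x y : ℝ) (hx : 0 ≤ x) (hy : 0 ≤ y) :
    |x - y| + (2:ℝ) ^ α * |x - y| ^ (1 + α) ≤ |TL α x - TL α y| := by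
  wlog h : x ≤ y generalizing x y
  · have := this y x hy hx (le_of_not_ge h)
    rwa [abs_sub_comm, abs_sub_comm (TL α x)]
  rw [abs_sub_comm, abs_sub_comm (TL α x), abs_of_nonneg (sub_nonneg.2 h)]
  refine le_trans ?_ (le_abs_self _)
  unfold TL
  have h1 : x ^ (1 + α) + (y - x) ^ (1 + α) ≤ y ^ (1 + α) := by
    have := Real.add_rpow_le_rpow_add (a := x) (b := y - x) hx (sub_nonneg.2 h)
      (p := 1 + α) (by linarith)
    simpa using this
  have h2 : (0:ℝ) < 2 ^ α := by positivity
  nlinarith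

/-- the distance controlling log-densities -/
noncomputable def dd (A x y : ℝ) : ℝ := A * |x - y| + 2 * |Real.log x - Real.log y|

lemma dd_comm (A x y : ℝ) : dd A x y = dd A y x := by
  unfold dd; rw [abs_sub_comm, abs_sub_comm (Real.log x)]

lemma dd_nonneg (A x y : ℝ) (hA : 0 ≤ A) : 0 ≤ dd A x y := by unfold dd; positivity

lemma TL_dd (A α : ℝ) (hA : 0 ≤ A) (hα : 0 < α) (hα1 : α ≤ 1) (x y : ℝ)
    (hx : 0 < x) (hy : 0 < y) :
    dd A x y + |Real.log (|TL' α x|) - Real.log (|TL' α y|)| ≤ dd A (TL α x) (TL α y) := by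
  wlog h : x ≤ y generalizing x y
  · have := this y x hy hx (le_of_not_ge h)
    rwa [dd_comm, abs_sub_comm, dd_comm A (TL α x)]
  have hE := TL_expand α hα x y hx.le hy.le
  have h2 : (0:ℝ) < 2 ^ α * |x - y| ^ (1 + α) + 1 := by positivity
  have h3 : |x - y| ≤ |TL α x - TL α y| := by
    have : (0:ℝ) ≤ 2 ^ α * |x - y| ^ (1 + α) := by positivity
    linarith
  set u := (2 * x) ^ α with hu
  set v := (2 * y) ^ α with hv
  have hu0 : 0 < u := by positivity
  have huv : u ≤ v := Real.rpow_le_rpow (by positivity) (by linarith) hα.le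
  have hv0 : 0 < v := by positivity
  have e1 : Real.log (TL α x) = Real.log x + Real.log (1 + u) := by
    rw [TL_eq α hα x hx, Real.log_mul hx.ne' (by positivity)]
  have e2 : Real.log (TL α y) = Real.log y + Real.log (1 + v) := by
    rw [TL_eq α hα y hy, Real.log_mul hy.ne' (by positivity)]
  have p1 : TL' α x = 1 + (1 + α) * u := rfl
  have p2 : TL' α y = 1 + (1 + α) * v := rfl
  have l1 : Real.log x ≤ Real.log y := Real.log_le_log hx h
  have l2 : Real.log (1 + u) ≤ Real.log (1 + v) := Real.log_le_log (by linarith) (by linarith)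
  have l3 : Real.log (1 + (1 + α) * u) ≤ Real.log (1 + (1 + α) * v) :=
    Real.log_le_log (by positivity) (by nlinarith)
  have l4 : Real.log (1 + (1 + α) * v) - Real.log (1 + (1 + α) * u)
      ≤ 2 * (Real.log (1 + v) - Real.log (1 + u)) := by
    have : Real.log ((1 + (1 + α) * v) * (1 + u) ^ 2) ≤
        Real.log ((1 + (1 + α) * u) * (1 + v) ^ 2) := by
      apply Real.log_le_log (by positivity)
      have : 0 ≤ (v - u) * ((1 - α) + u + v + (1 + α) * u * v) := by
        apply mul_nonneg (by linarith)
        have : 0 ≤ (1 + α) * u * v := by positivity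
        linarith
      nlinarith
    rw [Real.log_mul (by positivity) (by positivity), Real.log_mul (by positivity) (by positivity),
      Real.log_pow, Real.log_pow] at this
    push_cast at this
    linarith
  unfold dd
  rw [e1, e2, p1, p2, abs_of_pos (show 0 < 1 + (1 + α) * u by positivity),
    abs_of_pos (show 0 < 1 + (1 + α) * v by positivity),
    abs_sub_comm (Real.log x), abs_sub_comm (Real.log (1 + (1 + α) * u)),
    abs_of_nonneg (sub_nonneg.2 l1), abs_of_nonneg (sub_nonneg.2 l3),
    abs_sub_comm (Real.log x + _),
    abs_of_nonneg (show 0 ≤ Real.log y + Real.log (1 + v) - (Real.log x + Real.log (1 + u)) by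
      linarith)]
  nlinarith [mul_le_mul_of_nonneg_left h3 hA]

lemma TL_image (α : ℝ) (hα : 0 < α) : TL α '' Ioc 0 (1/2) = Ioc 0 1 := by
  have hhalf : TL α (1/2) = 1 := by rw [TL_eq α hα _ (by norm_num)]; norm_num
  have hmono : ∀ x y, 0 ≤ x → x ≤ y → TL α x ≤ TL α y := by
    intro x y hx hxy
    unfold TL
    have := Real.rpow_le_rpow hx hxy (z := 1 + α) (by linarith)
    have h2 : (0:ℝ) < 2 ^ α := by positivity
    nlinarith
  apply Subset.antisymm
  · rintro _ ⟨y, hy, rfl⟩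
    refine ⟨?_, ?_⟩
    · have hy0 := hy.1
      unfold TL; positivity
    · rw [← hhalf]; exact hmono _ _ hy.1.le hy.2
  · intro z hz
    have hc : ContinuousOn (TL α) (Icc 0 (1/2)) := by
      unfold TL
      apply Continuous.continuousOn
      have : Continuous fun y : ℝ => y ^ (1 + α) :=
        Real.continuous_rpow_const (by linarith)
      fun_prop
    have h0 : TL α 0 = 0 := by
      unfold TL; rw [Real.zero_rpow (by linarith)]; simp
    have := intermediate_value_Icc (by norm_num) hc
    rw [h0, hhalf] at this
    obtain ⟨y, hy, hyz⟩ := this ⟨hz.1.le, hz.2⟩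
    refine ⟨y, ⟨lt_of_le_of_ne hy.1 ?_, hy.2⟩, hyz⟩
    rintro rfl
    rw [h0] at hyz
    exact hz.1.ne hyz

lemma right_dd (lam C2 : ℝ) (hlam : 1 < lam) (T T' : ℝ → ℝ)
    (h1 : ∀ x ∈ Icc (1/2:ℝ) 1, ∀ y ∈ Icc (1/2:ℝ) 1, lam * |x - y| ≤ |T x - T y|)
    (h2 : ∀ x ∈ Icc (1/2:ℝ) 1, ∀ y ∈ Icc (1/2:ℝ) 1,
        |Real.log (|T' x|) - Real.log (|T' y|)| ≤ C2 * |x - y|)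
    (A : ℝ) (hA0 : 0 ≤ A) (hA : 4 + C2 ≤ A * (lam - 1)) :
    ∀ x ∈ Icc (1/2:ℝ) 1, ∀ y ∈ Icc (1/2:ℝ) 1,
      dd A x y + |Real.log (|T' x|) - Real.log (|T' y|)| ≤ dd A (T x) (T y) := by
  intro x hx y hy
  have key : ∀ x ∈ Icc (1/2:ℝ) 1, ∀ y ∈ Icc (1/2:ℝ) 1,
      Real.log x - Real.log y ≤ 2 * |x - y| := by
    intro x hx y hy
    have hx0 : 0 < x := by linarith [hx.1]
    have hy0 : 0 < y := by linarith [hy.1]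
    rw [← Real.log_div hx0.ne' hy0.ne']
    have h3 := Real.log_le_sub_one_of_pos (x := x / y) (by positivity)
    have : x / y - 1 ≤ 2 * |x - y| := by
      rw [div_sub_one hy0.ne', div_le_iff₀ hy0]
      nlinarith [le_abs_self (x - y), abs_nonneg (x - y), hy.1]
    linarith
  have hlog : |Real.log x - Real.log y| ≤ 2 * |x - y| := by
    rw [abs_le]
    constructor
    · have := key y hy x hx
      rw [abs_sub_comm] at this; linarith
    · exact key x hx y hy
  unfold dd
  have h3 := h1 x hx y hy
  have h4 := h2 x hx y hy
  have h5 := abs_nonneg (Real.log (T x) - Real.log (T y))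
  have h6 := abs_nonneg (x - y)
  nlinarith [mul_le_mul_of_nonneg_left h3 hA0, mul_le_mul_of_nonneg_right hA h6]

end VarIneq

open MeasureTheory Set

namespace VarIneq

/-- measures with a density in the log-Lipschitz cone -/
def Reg (A : ℝ) (ν : Measure ℝ) : Prop :=
  ∃ q : ℝ → ℝ, Measurable q ∧ (∀ x, 0 ≤ q x) ∧
    (∀ x ∈ Ioc (0:ℝ) 1, ∀ y ∈ Ioc (0:ℝ) 1, q x ≤ q y * Real.exp (dd A x y)) ∧
    ν = (volume.restrict (Ioc (0:ℝ) 1)).withDensity (fun x => ENNReal.ofReal (q x))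

lemma cone_continuous (A : ℝ) (q : ℝ → ℝ)
    (hq : ∀ x ∈ Ioc (0:ℝ) 1, ∀ y ∈ Ioc (0:ℝ) 1, q x ≤ q y * Real.exp (dd A x y)) :
    ContinuousOn q (Ioc (0:ℝ) 1) := by
  intro y hy
  have hd : ContinuousWithinAt (fun x => dd A x y) (Ioc (0:ℝ) 1) y := by
    unfold dd
    have h1 : ContinuousAt Real.log y := Real.continuousAt_log hy.1.ne'
    have : ContinuousAt (fun x => A * |x - y| + 2 * |Real.log x - Real.log y|) y := by
      fun_prop
    exact this.continuousWithinAt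
  have h0 : dd A y y = 0 := by simp [dd]
  have hup : Filter.Tendsto (fun x => q y * Real.exp (dd A x y)) (nhdsWithin y (Ioc 0 1))
      (nhds (q y)) := by
    have : ContinuousWithinAt (fun x => q y * Real.exp (dd A x y)) (Ioc (0:ℝ) 1) y := by
      fun_prop
    have h := this.tendsto
    simpa [h0] using h
  have hlo : Filter.Tendsto (fun x => q y * Real.exp (-dd A x y)) (nhdsWithin y (Ioc 0 1))
      (nhds (q y)) := by
    have : ContinuousWithinAt (fun x => q y * Real.exp (-dd A x y)) (Ioc (0:ℝ) 1) y := by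
      fun_prop
    have h := this.tendsto
    simpa [h0] using h
  refine tendsto_of_tendsto_of_tendsto_of_le_of_le' hlo hup ?_ ?_
  · filter_upwards [self_mem_nhdsWithin] with x hx
    have := hq y hy x hx
    rw [dd_comm] at this
    rw [Real.exp_neg, ← div_eq_mul_inv, div_le_iff₀ (Real.exp_pos _)]
    exact this
  · filter_upwards [self_mem_nhdsWithin] with x hx
    exact hq x hx y hy

lemma reg_branch (A : ℝ) (f f' : ℝ → ℝ) (s : Set ℝ) (hs : MeasurableSet s)
    (hsub : s ⊆ Ioc (0:ℝ) 1) (hf : Measurable f)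
    (hder : ∀ x ∈ s, HasDerivWithinAt f (f' x) s x) (hinj : InjOn f s)
    (himg : f '' s = Ioc (0:ℝ) 1) (hf'0 : ∀ x ∈ s, f' x ≠ 0)
    (hkey : ∀ x ∈ s, ∀ y ∈ s,
      dd A x y + |Real.log (|f' x|) - Real.log (|f' y|)| ≤ dd A (f x) (f y))
    (ν : Measure ℝ) (hν : Reg A ν) : Reg A ((ν.restrict s).map f) := by
  classical
  obtain ⟨q, hqm, hq0, hq, rfl⟩ := hν
  set S := Function.invFunOn f s with hS
  have hSmem : ∀ x ∈ Ioc (0:ℝ) 1, S x ∈ s := fun x hx =>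
    Function.invFunOn_mem (by rw [← himg] at hx; exact hx)
  have hSeq : ∀ x ∈ Ioc (0:ℝ) 1, f (S x) = x := fun x hx =>
    Function.invFunOn_eq (by rw [← himg] at hx; exact hx)
  have hSl : ∀ x ∈ s, S (f x) = x := fun x hx => hinj.leftInvOn_invFunOn hx
  have hfs : ∀ x ∈ s, f x ∈ Ioc (0:ℝ) 1 := fun x hx => himg ▸ mem_image_of_mem f hx
  have hcone : ∀ x ∈ Ioc (0:ℝ) 1, ∀ y ∈ Ioc (0:ℝ) 1,
      q (S x) / |f' (S x)| ≤ q (S y) / |f' (S y)| * Real.exp (dd A x y) := by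
    intro x hx y hy
    have hx' := hSmem x hx
    have hy' := hSmem y hy
    have px := abs_pos.2 (hf'0 _ hx')
    have py := abs_pos.2 (hf'0 _ hy')
    have h1 := hq _ (hsub hx') _ (hsub hy')
    have h2 := hkey _ hx' _ hy'
    rw [hSeq x hx, hSeq y hy] at h2
    have h3 : |f' (S y)| ≤ |f' (S x)| *
        Real.exp (|Real.log (|f' (S x)|) - Real.log (|f' (S y)|)|) := by
      calc |f' (S y)| = |f' (S x)| *
            Real.exp (Real.log (|f' (S y)|) - Real.log (|f' (S x)|)) := by
            rw [Real.exp_sub, Real.exp_log px, Real.exp_log py]; field_simp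
        _ ≤ _ := by
            gcongr
            rw [abs_sub_comm]; exact le_abs_self _
    rw [div_mul_eq_mul_div, div_le_div_iff₀ px py]
    calc q (S x) * |f' (S y)| ≤ (q (S y) * Real.exp (dd A (S x) (S y))) * (|f' (S x)| *
        Real.exp (|Real.log (|f' (S x)|) - Real.log (|f' (S y)|)|)) := by
          gcongr
          exact mul_nonneg (hq0 _) (Real.exp_pos _).le
      _ = q (S y) * |f' (S x)| * Real.exp (dd A (S x) (S y) +
          |Real.log (|f' (S x)|) - Real.log (|f' (S y)|)|) := by rw [Real.exp_add]; ring
      _ ≤ q (S y) * |f' (S x)| * Real.exp (dd A x y) := by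
          have := hq0 (S y)
          gcongr
      _ = _ := by ring
  set q' : ℝ → ℝ := (Ioc (0:ℝ) 1).piecewise (fun x => q (S x) / |f' (S x)|) (fun _ => 0) with hq'
  have hq'in : ∀ x ∈ Ioc (0:ℝ) 1, q' x = q (S x) / |f' (S x)| := fun x hx =>
    piecewise_eq_of_mem _ _ _ hx
  have hq'm : Measurable q' :=
    (cone_continuous A _ hcone).measurable_piecewise continuousOn_const measurableSet_Ioc
  refine ⟨q', hq'm, ?_, ?_, ?_⟩
  · intro x
    by_cases hx : x ∈ Ioc (0:ℝ) 1
    · rw [hq'in x hx]; exact div_nonneg (hq0 _) (abs_nonneg _)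
    · rw [hq', piecewise_eq_of_notMem _ _ _ hx]
  · intro x hx y hy
    rw [hq'in x hx, hq'in y hy]; exact hcone x hx y hy
  · ext t ht
    rw [Measure.map_apply hf ht, Measure.restrict_apply (hf ht),
      withDensity_apply _ ((hf ht).inter hs), withDensity_apply _ ht,
      Measure.restrict_restrict ((hf ht).inter hs), Measure.restrict_restrict ht]
    have e1 : f ⁻¹' t ∩ s ∩ Ioc 0 1 = f ⁻¹' t ∩ s := by
      apply inter_eq_left.2
      exact fun x hx => hsub hx.2
    rw [e1, ← Measure.restrict_restrict (hf ht), ← Measure.restrict_restrict ht,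
      ← lintegral_indicator (hf ht), ← lintegral_indicator ht, ← himg,
      lintegral_image_eq_lintegral_abs_deriv_mul hs hder hinj]
    apply setLIntegral_congr_fun hs
    intro x hx
    by_cases hxt : f x ∈ t
    · have : x ∈ f ⁻¹' t := hxt
      simp only [indicator_of_mem hxt, indicator_of_mem this]
      rw [hq'in _ (hfs x hx), hSl x hx, ← ENNReal.ofReal_mul (abs_nonneg _),
        mul_div_cancel₀ _ (abs_pos.2 (hf'0 x hx)).ne']
    · have : x ∉ f ⁻¹' t := hxt
      simp only [indicator_of_notMem hxt, indicator_of_notMem this, mul_zero]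

lemma Reg.null {A : ℝ} {ν : Measure ℝ} (hν : Reg A ν) {s : Set ℝ}
    (hs : volume (s ∩ Ioc 0 1) = 0) : ν s = 0 := by
  obtain ⟨q, -, -, -, rfl⟩ := hν
  apply withDensity_absolutelyContinuous
  rw [Measure.restrict_apply' measurableSet_Ioc]; exact hs

/-- the two elements of the partition -/
def side (b : Bool) : Set ℝ := if b then Iio (1/2) else Ici (1/2)

lemma measurableSet_side (b : Bool) : MeasurableSet (side b) := by
  cases b <;> simp [side, measurableSet_Iio, measurableSet_Ici]

lemma reg_left (A α : ℝ) (hA : 0 ≤ A) (hα : 0 < α) (hα1 : α ≤ 1) (T : ℝ → ℝ)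
    (hT : Measurable T)
    (hT_formula : ∀ x ∈ Ico (0:ℝ) (1/2), T x = x + (2:ℝ) ^ α * x ^ (1 + α))
    (ν : Measure ℝ) (hν : Reg A ν) : Reg A ((ν.restrict (Iio (1/2))).map T) := by
  have hm : Measurable (TL α) := by unfold TL; fun_prop
  have h := reg_branch A (TL α) (TL' α) (Ioc 0 (1/2)) measurableSet_Ioc
    (Ioc_subset_Ioc_right (by norm_num)) hm
    (fun x hx => (TL_hasDeriv α hα x hx.1).hasDerivWithinAt)
    (fun x hx y hy hxy => by
      have := TL_expand α hα x y hx.1.le hy.1.le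
      rw [hxy, sub_self, abs_zero] at this
      have h2 : (0:ℝ) ≤ 2 ^ α * |x - y| ^ (1 + α) := by positivity
      have h3 : |x - y| = 0 := le_antisymm (by linarith) (abs_nonneg _)
      exact sub_eq_zero.1 (abs_eq_zero.1 h3))
    (TL_image α hα)
    (fun x hx => by
      have := hx.1
      have : 0 < TL' α x := by unfold TL'; positivity
      exact this.ne')
    (fun x hx y hy => TL_dd A α hA hα hα1 x y hx.1 hy.1) ν hν
  have e1 : ν.restrict (Iio (1/2)) = ν.restrict (Ioc 0 (1/2)) := by
    apply Measure.restrict_congr_set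
    rw [ae_eq_set]
    constructor
    · apply hν.null
      have : (Iio (1/2:ℝ) \ Ioc 0 (1/2)) ∩ Ioc 0 1 = ∅ := by
        ext x; simp only [mem_inter_iff, mem_diff, mem_Iio, mem_Ioc, mem_empty_iff_false, iff_false]
        rintro ⟨⟨h1, h2⟩, h3, h4⟩
        exact h2 ⟨h3, h1.le⟩
      rw [this]; simp
    · apply hν.null
      apply measure_mono_null (t := {(1/2:ℝ)}) _ (by simp)
      rintro x ⟨⟨h1, h2⟩, h3⟩
      simp only [mem_Iio, not_lt] at h2
      exact le_antisymm h1.2 h2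
  have e2 : (ν.restrict (Iio (1/2))).map T = (ν.restrict (Iio (1/2))).map (TL α) := by
    apply Measure.map_congr
    rw [Filter.EventuallyEq, ae_restrict_iff' measurableSet_Iio]
    have : ∀ᵐ x ∂ν, x ∈ Ioc (0:ℝ) 1 := by
      rw [ae_iff]
      apply hν.null
      have : {a | a ∉ Ioc (0:ℝ) 1} ∩ Ioc 0 1 = ∅ := by ext; simp
      rw [this]; simp
    filter_upwards [this] with x hx hx2
    exact hT_formula x ⟨hx.1.le, hx2⟩
  rw [e2, e1]; exact h

lemma reg_right (A : ℝ) (T T' : ℝ → ℝ) (hT : Measurable T)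
    (hT_deriv : ∀ x ∈ Icc (1/2:ℝ) 1, HasDerivWithinAt T (T' x) (Icc (1/2:ℝ) 1) x)
    (hT_bij : BijOn T (Icc (1/2:ℝ) 1) (Icc (0:ℝ) 1))
    (hT_expanding : ∀ x ∈ Icc (1/2:ℝ) 1, 1 < |T' x|)
    (hkey : ∀ x ∈ Icc (1/2:ℝ) 1, ∀ y ∈ Icc (1/2:ℝ) 1,
      dd A x y + |Real.log (|T' x|) - Real.log (|T' y|)| ≤ dd A (T x) (T y))
    (ν : Measure ℝ) (hν : Reg A ν) : Reg A ((ν.restrict (Ici (1/2))).map T) := by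
  set s : Set ℝ := Icc (1/2) 1 ∩ T ⁻¹' (Ioc 0 1) with hs
  have hsm : MeasurableSet s := measurableSet_Icc.inter (hT measurableSet_Ioc)
  have hss : s ⊆ Icc (1/2) 1 := inter_subset_left
  have h := reg_branch A T T' s hsm
    (fun x hx => ⟨by linarith [hx.1.1], hx.1.2⟩) hT
    (fun x hx => (hT_deriv x (hss hx)).mono hss) (hT_bij.injOn.mono hss)
    (by
      apply Subset.antisymm
      · rintro _ ⟨x, hx, rfl⟩; exact hx.2
      · intro y hy
        obtain ⟨x, hx, rfl⟩ := hT_bij.surjOn (Ioc_subset_Icc_self hy)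
        exact ⟨x, ⟨hx, hy⟩, rfl⟩)
    (fun x hx h0 => by
      have := hT_expanding x (hss hx)
      rw [h0] at this; norm_num at this)
    (fun x hx y hy => hkey x (hss hx) y (hss hy)) ν hν
  have e1 : ν.restrict (Ici (1/2)) = ν.restrict s := by
    apply Measure.restrict_congr_set
    rw [ae_eq_set]
    constructor
    · apply hν.null
      obtain ⟨z, hz, hz0⟩ := hT_bij.surjOn (show (0:ℝ) ∈ Icc (0:ℝ) 1 by simp)
      apply measure_mono_null (t := {z}) _ (by simp)
      rintro x ⟨⟨h1, h2⟩, h3⟩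
      have hx : x ∈ Icc (1/2:ℝ) 1 := ⟨h1, h3.2⟩
      have hTx := hT_bij.mapsTo hx
      by_contra hxz
      apply h2
      refine ⟨hx, lt_of_le_of_ne hTx.1 ?_, hTx.2⟩
      intro h0
      exact hxz (hT_bij.injOn hx hz (by rw [hz0]; exact h0.symm))
    · have : s \ Ici (1/2:ℝ) = ∅ := by
        rw [diff_eq_empty]; exact fun x hx => hx.1.1
      rw [this]; simp
  rw [e1]; exact h

lemma Reg.ae_mem {A : ℝ} {ν : Measure ℝ} (hν : Reg A ν) : ∀ᵐ x ∂ν, x ∈ Ioc (0:ℝ) 1 := by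
  rw [ae_iff]
  apply hν.null
  have : {a | a ∉ Ioc (0:ℝ) 1} ∩ Ioc 0 1 = ∅ := by ext; simp
  rw [this]; simp

lemma Reg.add {A : ℝ} {ν ν' : Measure ℝ} (hν : Reg A ν) (hν' : Reg A ν') : Reg A (ν + ν') := by
  obtain ⟨q, hqm, hq0, hq, rfl⟩ := hν
  obtain ⟨p, hpm, hp0, hp, rfl⟩ := hν'
  refine ⟨fun x => q x + p x, hqm.add hpm, fun x => add_nonneg (hq0 x) (hp0 x), ?_, ?_⟩
  · intro x hx y hy
    have := hq x hx y hy
    have := hp x hx y hy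
    linarith
  · rw [← withDensity_add_left (by fun_prop)]
    congr 1; ext x
    simp [ENNReal.ofReal_add (hq0 x) (hp0 x)]

lemma reg_lebesgue (A : ℝ) (hA : 0 ≤ A) : Reg A (volume.restrict (Ioc (0:ℝ) 1)) := by
  refine ⟨fun _ => 1, measurable_const, fun _ => zero_le_one, ?_, ?_⟩
  · intro x _ y _
    simpa using dd_nonneg A x y hA
  · simp

lemma reg_push (A : ℝ) (T : ℝ → ℝ) (hT : Measurable T)
    (hb : ∀ b ν, Reg A ν → Reg A ((ν.restrict (side b)).map T)) (ν : Measure ℝ) (hν : Reg A ν) :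
    Reg A (ν.map T) := by
  have h := (hb true ν hν).add (hb false ν hν)
  rw [← Measure.map_add _ _ hT] at h
  convert h using 2
  have : side false = (side true)ᶜ := by ext; simp [side]
  rw [this, Measure.restrict_add_restrict_compl (measurableSet_side true)]

lemma reg_push_iter (A : ℝ) (T : ℝ → ℝ) (hT : Measurable T)
    (hb : ∀ b ν, Reg A ν → Reg A ((ν.restrict (side b)).map T)) (ν : Measure ℝ) (hν : Reg A ν)
    (N : ℕ) : Reg A (ν.map T^[N]) := by
  induction N with
  | zero => simpa using hν
  | succ N ih =>
    have := reg_push A T hT hb _ ih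
    rwa [Measure.map_map hT (hT.iterate N), ← Function.iterate_succ'] at this

/-- cylinder sets -/
def cyl (T : ℝ → ℝ) (J : ℕ) (a : ℕ → Bool) : Set ℝ := {x | ∀ i < J, T^[i] x ∈ side (a i)}

lemma cyl_succ (T : ℝ → ℝ) (J : ℕ) (a : ℕ → Bool) :
    cyl T (J + 1) a = cyl T J a ∩ T^[J] ⁻¹' (side (a J)) := by
  ext x
  simp only [cyl, mem_setOf_eq, mem_inter_iff, mem_preimage, Nat.lt_succ_iff_lt_or_eq]
  constructor
  · intro h; exact ⟨fun i hi => h i (Or.inl hi), h J (Or.inr rfl)⟩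
  · rintro ⟨h1, h2⟩ i (hi | rfl)
    · exact h1 i hi
    · exact h2

lemma measurableSet_cyl (T : ℝ → ℝ) (hT : Measurable T) (J : ℕ) (a : ℕ → Bool) :
    MeasurableSet (cyl T J a) := by
  induction J with
  | zero => simp [cyl]
  | succ J ih => rw [cyl_succ]; exact ih.inter ((hT.iterate J) (measurableSet_side _))

lemma reg_cyl (A : ℝ) (T : ℝ → ℝ) (hT : Measurable T)
    (hb : ∀ b ν, Reg A ν → Reg A ((ν.restrict (side b)).map T)) (ν : Measure ℝ) (hν : Reg A ν)
    (a : ℕ → Bool) (J : ℕ) : Reg A ((ν.restrict (cyl T J a)).map T^[J]) := by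
  induction J with
  | zero => simpa [cyl] using hν
  | succ J ih =>
    have := hb (a J) _ ih
    rw [Measure.restrict_map (hT.iterate J) (measurableSet_side _),
      Measure.map_map hT (hT.iterate J), ← Function.iterate_succ',
      Measure.restrict_restrict ((hT.iterate J) (measurableSet_side _))] at this
    rwa [cyl_succ, inter_comm]

end VarIneq

open MeasureTheory Set

namespace VarIneq

lemma decay_meas (μ : Measure ℝ) [IsProbabilityMeasure μ] (T : ℝ → ℝ) (hT : MeasurePreserving T μ μ)
    (hsupp : ∀ᵐ x ∂μ, x ∈ Icc (0:ℝ) 1) (r : ℕ → ℝ)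
    (hdecay : ∀ (v w : ℝ → ℝ) (Mv : ℝ) (Lw : NNReal),
      ContinuousOn v (Icc (0:ℝ) 1) → (∀ x ∈ Icc (0:ℝ) 1, |v x| ≤ Mv) →
      LipschitzOnWith Lw w (Icc (0:ℝ) 1) →
      ∀ ℓ : ℕ, 1 ≤ ℓ →
        |(∫ x, v (T^[ℓ] x) * w x ∂μ) - (∫ x, v x ∂μ) * (∫ x, w x ∂μ)| ≤ Mv * (Lw : ℝ) * r ℓ)
    (v w : ℝ → ℝ) (Mv : ℝ) (Lw : NNReal) (hv : Measurable v) (hvM : ∀ x, |v x| ≤ Mv)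
    (hwc : Continuous w) (hwL : LipschitzOnWith Lw w (Icc (0:ℝ) 1)) (ℓ : ℕ) (hℓ : 1 ≤ ℓ) :
    |(∫ x, v (T^[ℓ] x) * w x ∂μ) - (∫ x, v x ∂μ) * (∫ x, w x ∂μ)| ≤ Mv * (Lw : ℝ) * r ℓ := by
  obtain ⟨Bw, hBw⟩ := isCompact_Icc.exists_bound_of_continuousOn (s := Icc (0:ℝ) 1) hwc.continuousOn
  have hBw0 : 0 ≤ Bw := (norm_nonneg _).trans (hBw 0 (by simp))
  have hMv0 : 0 ≤ Mv := (abs_nonneg _).trans (hvM 0)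
  have hwB : ∀ᵐ x ∂μ, ‖w x‖ ≤ Bw := hsupp.mono fun x hx => hBw x hx
  have hwi : Integrable w μ := Integrable.of_bound hwc.aestronglyMeasurable Bw hwB
  have hvi : Integrable v μ := Integrable.of_bound hv.aestronglyMeasurable Mv (ae_of_all _ hvM)
  have hTl := hT.iterate ℓ
  apply le_of_forall_pos_le_add
  intro ε hε
  set δ : ℝ := ε / (2 * Bw + 1) with hδ
  have hδ0 : 0 < δ := by positivity
  obtain ⟨g, hg, hgi⟩ := hvi.exists_boundedContinuous_integral_sub_le hδ0
  set g' : ℝ → ℝ := fun x => max (-Mv) (min (g x) Mv) with hg'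
  have hg'c : Continuous g' := by
    have := g.continuous
    fun_prop
  have hg'M : ∀ x, |g' x| ≤ Mv := by
    intro x
    rw [abs_le]
    exact ⟨le_max_left _ _, max_le (by linarith) (min_le_right _ _)⟩
  have hdiff : ∀ x, |v x - g' x| ≤ |v x - g x| := by
    intro x
    have := abs_le.1 (hvM x)
    simp only [hg']
    rcases le_total (g x) Mv with h1 | h1
    · rw [min_eq_left h1]
      rcases le_total (-Mv) (g x) with h2 | h2
      · rw [max_eq_right h2]
      · rw [max_eq_left h2, abs_of_nonneg (by linarith), abs_of_nonneg (by linarith)]; linarith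
    · rw [min_eq_right h1, max_eq_right (by linarith), abs_of_nonpos (by linarith), abs_of_nonpos (by linarith)]
      linarith
  have hg'i : Integrable g' μ := Integrable.of_bound hg'c.aestronglyMeasurable Mv (ae_of_all _ hg'M)
  have hI : ∫ x, |v x - g' x| ∂μ ≤ δ := by
    refine le_trans (integral_mono (hvi.sub hg'i).abs (hvi.sub hgi).abs hdiff) ?_
    simpa using hg
  have hmain := hdecay g' w Mv Lw hg'c.continuousOn (fun x _ => hg'M x) hwL ℓ hℓ
  have hiv : Integrable (fun x => v (T^[ℓ] x) * w x) μ :=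
    hwi.bdd_mul (c := Mv) (hv.comp hTl.measurable).aestronglyMeasurable (ae_of_all _ fun x => hvM _)
  have hig : Integrable (fun x => g' (T^[ℓ] x) * w x) μ :=
    hwi.bdd_mul (c := Mv) (hg'c.measurable.comp hTl.measurable).aestronglyMeasurable (ae_of_all _ fun x => hg'M _)
  have h1 : |(∫ x, v (T^[ℓ] x) * w x ∂μ) - ∫ x, g' (T^[ℓ] x) * w x ∂μ| ≤ Bw * δ := by
    rw [← integral_sub hiv hig]
    refine (abs_integral_le_integral_abs).trans ?_
    have : ∫ x, |v (T^[ℓ] x) - g' (T^[ℓ] x)| ∂μ ≤ δ := by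
      have := integral_map (μ := μ) hTl.measurable.aemeasurable (f := fun x => |v x - g' x|)
        ((hv.sub hg'c.measurable).abs.aestronglyMeasurable)
      rw [hTl.map_eq] at this
      rw [← this]; exact hI
    calc _ ≤ ∫ x, Bw * |v (T^[ℓ] x) - g' (T^[ℓ] x)| ∂μ := by
            refine integral_mono_ae (hiv.sub hig).abs ?_ ?_
            · exact (hTl.integrable_comp_of_integrable (hvi.sub hg'i)).abs.const_mul Bw
            · filter_upwards [hwB] with x hx
              rw [← sub_mul, abs_mul, mul_comm]
              exact mul_le_mul_of_nonneg_right hx (abs_nonneg _)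
      _ ≤ Bw * δ := by rw [integral_const_mul]; gcongr
  have hwI : |∫ x, w x ∂μ| ≤ Bw := by
    have := norm_integral_le_of_norm_le_const hwB
    simpa using this
  have h2 : |(∫ x, g' x ∂μ) * (∫ x, w x ∂μ) - (∫ x, v x ∂μ) * (∫ x, w x ∂μ)| ≤ δ * Bw := by
    rw [← sub_mul, abs_mul, ← integral_sub hg'i hvi]
    refine mul_le_mul ?_ hwI (abs_nonneg _) hδ0.le
    refine (abs_integral_le_integral_abs).trans ?_
    simpa only [abs_sub_comm] using hI
  have h3 : Bw * δ + δ * Bw ≤ ε := by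
    have : δ * (2 * Bw + 1) = ε := by rw [hδ]; field_simp
    nlinarith
  have := abs_le.1 h1
  have := abs_le.1 h2
  have := abs_le.1 hmain
  rw [abs_le]; constructor <;> linarith

/-- approximation of the pushed Lebesgue measure -/
lemma tv_approx (μ : Measure ℝ) [IsProbabilityMeasure μ] (T : ℝ → ℝ) (hT : MeasurePreserving T μ μ)
    (hsupp : ∀ᵐ x ∂μ, x ∈ Icc (0:ℝ) 1) (r : ℕ → ℝ) (hr : Filter.Tendsto r Filter.atTop (nhds 0))
    (hdecay : ∀ (v w : ℝ → ℝ) (Mv : ℝ) (Lw : NNReal), Measurable v → (∀ x, |v x| ≤ Mv) →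
      Continuous w → LipschitzOnWith Lw w (Icc (0:ℝ) 1) →
      ∀ ℓ : ℕ, 1 ≤ ℓ →
        |(∫ x, v (T^[ℓ] x) * w x ∂μ) - (∫ x, v x ∂μ) * (∫ x, w x ∂μ)| ≤ Mv * (Lw : ℝ) * r ℓ)
    (m : Measure ℝ) [IsProbabilityMeasure m] (hm : m ≪ μ) (ε : ℝ) (hε : 0 < ε) :
    ∃ N : ℕ, ∀ v : ℝ → ℝ, Measurable v → (∀ x, |v x| ≤ 1) →
      |∫ x, v x ∂(m.map T^[N]) - ∫ x, v x ∂μ| ≤ ε := by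
  set g : ℝ → ℝ := fun x => (m.rnDeriv μ x).toReal with hg
  have hgi : Integrable g μ := Measure.integrable_toReal_rnDeriv
  obtain ⟨f, hf, hfi⟩ := hgi.exists_boundedContinuous_integral_sub_le (ε := ε/6) (by positivity)
  obtain ⟨p, hp⟩ := exists_polynomial_near_of_continuousOn 0 1 f f.continuous.continuousOn (ε/6) (by positivity)
  set w : ℝ → ℝ := fun x => p.eval x with hw
  have hwc : Continuous w := p.continuous
  obtain ⟨Lw, hLw⟩ : ∃ Lw, LipschitzOnWith Lw w (Icc (0:ℝ) 1) := by
    have : ContDiffOn ℝ 1 w (Icc (0:ℝ) 1) := by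
      apply ContDiff.contDiffOn
      simpa [hw, Polynomial.aeval_def] using (p.contDiff_aeval (𝕜 := ℝ) 1)
    exact this.exists_lipschitzOnWith (by norm_num) (convex_Icc 0 1) isCompact_Icc
  obtain ⟨Bw, hBw⟩ := isCompact_Icc.exists_bound_of_continuousOn (s := Icc (0:ℝ) 1) hwc.continuousOn
  have hwB : ∀ᵐ x ∂μ, ‖w x‖ ≤ Bw := hsupp.mono fun x hx => hBw x hx
  have hwi : Integrable w μ := Integrable.of_bound hwc.aestronglyMeasurable Bw hwB
  have hgw : ∫ x, |g x - w x| ∂μ ≤ ε/3 := by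
    calc _ ≤ ∫ x, (|g x - f x| + ε/6) ∂μ := by
            refine integral_mono_ae (hgi.sub hwi).abs ((hgi.sub hfi).abs.add (integrable_const _)) ?_
            filter_upwards [hsupp] with x hx
            have := hp x hx
            have h1 := abs_sub_le (g x) (f x) (w x)
            rw [abs_sub_comm] at this
            simp only [hw] at h1 ⊢
            linarith
      _ ≤ ε/3 := by
            rw [integral_add (f := fun x => |g x - f x|) (hgi.sub hfi).abs (integrable_const _)]
            simp only [integral_const, probReal_univ, smul_eq_mul, one_mul]
            have : ∫ x, |g x - f x| ∂μ ≤ ε/6 := by simpa using hf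
            linarith
  obtain ⟨N, hN1, hN⟩ : ∃ N : ℕ, 1 ≤ N ∧ (Lw:ℝ) * r N ≤ ε/3 := by
    have h1 : Filter.Tendsto (fun N => (Lw:ℝ) * r N) Filter.atTop (nhds 0) := by
      simpa using hr.const_mul (Lw:ℝ)
    have h2 := h1.eventually (ge_mem_nhds (show (0:ℝ) < ε/3 by positivity))
    exact ((Filter.eventually_ge_atTop 1).and h2).exists
  refine ⟨N, fun v hv hv1 => ?_⟩
  have hTN := hT.iterate N
  have hb : ∀ (u : ℝ → ℝ), Integrable u μ → Integrable (fun x => v (T^[N] x) * u x) μ := fun u hu =>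
    hu.bdd_mul (c := 1) (hv.comp hTN.measurable).aestronglyMeasurable (ae_of_all _ fun x => hv1 _)
  have e1 : ∫ x, v x ∂(m.map T^[N]) = ∫ x, v (T^[N] x) * g x ∂μ := by
    rw [integral_map hTN.measurable.aemeasurable hv.aestronglyMeasurable,
      ← integral_rnDeriv_smul hm]
    simp only [smul_eq_mul, hg, mul_comm]
  have hg1 : ∫ x, g x ∂μ = 1 := by
    have := integral_rnDeriv_smul (f := fun _ => (1:ℝ)) hm
    simpa [hg] using this
  have h1 : |∫ x, v (T^[N] x) * g x ∂μ - ∫ x, v (T^[N] x) * w x ∂μ| ≤ ε/3 := by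
    rw [← integral_sub (hb g hgi) (hb w hwi)]
    refine (abs_integral_le_integral_abs).trans (le_trans ?_ hgw)
    refine integral_mono ((hb g hgi).sub (hb w hwi)).abs (hgi.sub hwi).abs fun x => ?_
    rw [← mul_sub, abs_mul]
    exact mul_le_of_le_one_left (abs_nonneg _) (hv1 _)
  have h2 := hdecay v w 1 Lw hv hv1 hwc hLw N hN1
  have hvI : |∫ x, v x ∂μ| ≤ 1 := by
    have := norm_integral_le_of_norm_le_const (μ := μ) (f := v) (C := 1) (ae_of_all _ hv1)
    simpa using this
  have h3 : |(∫ x, v x ∂μ) * (∫ x, w x ∂μ) - ∫ x, v x ∂μ| ≤ ε/3 := by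
    have : (∫ x, v x ∂μ) * (∫ x, w x ∂μ) - ∫ x, v x ∂μ = (∫ x, v x ∂μ) * ((∫ x, w x ∂μ) - ∫ x, g x ∂μ) := by
      rw [hg1]; ring
    rw [this, abs_mul]
    refine (mul_le_of_le_one_left (abs_nonneg _) hvI).trans ?_
    rw [← integral_sub hwi hgi]
    refine (abs_integral_le_integral_abs).trans ?_
    simpa only [abs_sub_comm] using hgw
  rw [e1]
  have := abs_le.1 h1
  have := abs_le.1 h2
  have := abs_le.1 h3
  rw [abs_le]; constructor <;> linarith

lemma dens_ac (α : ℝ) (hα0 : 0 < α) (h : ℝ → ℝ) (c₁ c₂ : ℝ) (hc₁ : 0 < c₁)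
    (hdens : ∀ x ∈ Ioc (0:ℝ) 1, c₁ * x ^ (-α) ≤ h x ∧ h x ≤ c₂ * x ^ (-α))
    (μ : Measure ℝ)
    (hμ : μ = (volume.restrict (Icc (0:ℝ) 1)).withDensity (fun x => ENNReal.ofReal (h x))) :
    volume.restrict (Ioc (0:ℝ) 1) ≪ μ := by
  have hle : ENNReal.ofReal c₁ • volume.restrict (Ioc (0:ℝ) 1) ≤ μ := by
    rw [hμ, ← restrict_Ioc_eq_restrict_Icc, ← withDensity_const]
    apply withDensity_mono
    filter_upwards [ae_restrict_mem measurableSet_Ioc] with x hx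
    apply ENNReal.ofReal_le_ofReal
    refine le_trans ?_ (hdens x hx).1
    have : 1 ≤ x ^ (-α) := Real.one_le_rpow_of_pos_of_le_one_of_nonpos hx.1 hx.2 (by linarith)
    nlinarith
  refine Measure.AbsolutelyContinuous.trans ?_ (Measure.absolutelyContinuous_of_le hle)
  exact Measure.absolutelyContinuous_smul (by simpa using hc₁)

lemma dens_int (α : ℝ) (hα0 : 0 < α) (hα7 : 7 * α ≤ 1) (h : ℝ → ℝ) (c₁ c₂ : ℝ) (hc₁ : 0 < c₁) (hc₁₂ : c₁ ≤ c₂)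
    (hdens : ∀ x ∈ Ioc (0:ℝ) 1, c₁ * x ^ (-α) ≤ h x ∧ h x ≤ c₂ * x ^ (-α))
    (μ : Measure ℝ)
    (hμ : μ = (volume.restrict (Icc (0:ℝ) 1)).withDensity (fun x => ENNReal.ofReal (h x))) :
    Integrable (fun u : ℝ => u ^ (-(5/6:ℝ))) μ := by
  have hle : μ ≤ (volume.restrict (Ioc (0:ℝ) 1)).withDensity (fun x => ENNReal.ofReal (c₂ * x ^ (-α))) := by
    rw [hμ, ← restrict_Ioc_eq_restrict_Icc]
    apply withDensity_mono
    filter_upwards [ae_restrict_mem measurableSet_Ioc] with x hx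
    exact ENNReal.ofReal_le_ofReal (hdens x hx).2
  refine Integrable.mono_measure ?_ hle
  have hmeas : Measurable (fun x : ℝ => c₂ * x ^ (-α)) := by fun_prop
  rw [integrable_withDensity_iff (by fun_prop) (ae_of_all _ fun x => ENNReal.ofReal_lt_top)]
  have h1 : IntegrableOn (fun x : ℝ => c₂ * x ^ (-(5/6:ℝ) - α)) (Ioc 0 1) := by
    apply Integrable.const_mul
    rw [← IntegrableOn, ← intervalIntegrable_iff_integrableOn_Ioc_of_le zero_le_one]
    exact intervalIntegral.intervalIntegrable_rpow' (by linarith)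
  refine h1.congr ?_
  filter_upwards [ae_restrict_mem measurableSet_Ioc] with x hx
  rw [ENNReal.toReal_ofReal (by have := Real.rpow_nonneg hx.1.le (-α); nlinarith), sub_eq_add_neg, Real.rpow_add hx.1]
  ring

lemma dens_ae (h : ℝ → ℝ) (μ : Measure ℝ)
    (hμ : μ = (volume.restrict (Icc (0:ℝ) 1)).withDensity (fun x => ENNReal.ofReal (h x))) :
    ∀ᵐ x ∂μ, x ∈ Ioc (0:ℝ) 1 := by
  have : μ ≪ volume.restrict (Ioc (0:ℝ) 1) := by
    rw [hμ, ← restrict_Ioc_eq_restrict_Icc]; exact withDensity_absolutelyContinuous _ _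
  exact this.ae_le (ae_restrict_mem measurableSet_Ioc)

end VarIneq

open MeasureTheory Set

namespace VarIneq

noncomputable def ramp (N q : ℕ) (u : ℝ) : ℝ := max 0 (min 1 ((N:ℝ) * u - q))

lemma ramp_continuous (N q : ℕ) : Continuous (ramp N q) := by unfold ramp; fun_prop

lemma ramp_lip (N q : ℕ) : LipschitzWith (N : NNReal) (ramp N q) := by
  have h1 : LipschitzWith (N : NNReal) (fun u : ℝ => (N:ℝ) * u - q) := by
    apply LipschitzWith.of_dist_le_mul
    intro x y
    rw [Real.dist_eq, Real.dist_eq]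
    have : (N:ℝ) * x - q - (N * y - q) = N * (x - y) := by ring
    rw [this, abs_mul]; simp
  exact (h1.const_min 1).const_max 0

lemma ramp_bound (N q : ℕ) (u : ℝ) : |ramp N q u| ≤ 1 := by
  unfold ramp
  rw [abs_of_nonneg (le_max_left _ _)]
  exact max_le zero_le_one (min_le_left _ _)

lemma ramp_sum (F : ℕ → ℝ) (s : ℝ) (hs : 0 ≤ s) (n : ℕ) :
    F 0 + ∑ q ∈ Finset.range n, (F (q+1) - F q) * max 0 (min 1 (s - q)) =
      if n ≤ ⌊s⌋₊ then F n else F ⌊s⌋₊ + (F (⌊s⌋₊ + 1) - F ⌊s⌋₊) * (s - ⌊s⌋₊) := by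
  have hk1 := Nat.floor_le hs
  have hk2 := Nat.lt_floor_add_one s
  induction n with
  | zero => simp
  | succ n ih =>
    rw [Finset.sum_range_succ, ← add_assoc, ih]
    rcases lt_trichotomy n ⌊s⌋₊ with h | h | h
    · rw [if_pos h.le, if_pos (by omega)]
      have : (n:ℝ) + 1 ≤ ⌊s⌋₊ := by exact_mod_cast h
      rw [min_eq_left (by linarith), max_eq_right zero_le_one]; ring
    · rw [if_pos h.le, if_neg (by omega), ← h]
      rw [← h] at hk1 hk2
      rw [min_eq_right (by linarith), max_eq_right (by linarith)]
    · rw [if_neg (by omega), if_neg (by omega)]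
      have : (⌊s⌋₊:ℝ) + 1 ≤ n := by exact_mod_cast h
      rw [max_eq_left ((min_le_right _ _).trans (by linarith))]; ring

noncomputable def FF (W : ℝ → ℝ → ℝ) (N q : ℕ) (y : ℝ) : ℝ := W ((max (q:ℝ) 1) / N) y

noncomputable def WN (W : ℝ → ℝ → ℝ) (N : ℕ) (u y : ℝ) : ℝ :=
  FF W N 0 y + ∑ q ∈ Finset.range N, (FF W N (q+1) y - FF W N q y) * ramp N q u

lemma WN_approx (W : ℝ → ℝ → ℝ) (M C : ℝ) (hC : 0 ≤ C) (hW : ∀ u y, |W u y| ≤ M)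
    (hreg : ∀ u u' y, 0 < u → u ≤ u' → u' ≤ 1 → |W u y - W u' y| ≤ C * M * ((u' - u) / u))
    (N : ℕ) (hN : 1 ≤ N) (u y : ℝ) (hu0 : 0 < u) (hu1 : u ≤ 1) :
    |W u y - WN W N u y| ≤ (2 * C + 2) * M * ((N:ℝ) ^ (-(5/6:ℝ)) * u ^ (-(5/6:ℝ))) := by
  have hM0 : 0 ≤ M := (abs_nonneg _).trans (hW 0 0)
  have hN0 : (0:ℝ) < N := by exact_mod_cast hN
  set s : ℝ := N * u with hs
  have hs0 : 0 < s := by positivity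
  have hsN : s ≤ N := by nlinarith
  rw [← Real.mul_rpow hN0.le hu0.le, ← hs]
  have hWN : WN W N u y = FF W N ⌊s⌋₊ y + (FF W N (⌊s⌋₊+1) y - FF W N ⌊s⌋₊ y) * (s - ⌊s⌋₊) := by
    have := ramp_sum (fun q => FF W N q y) s hs0.le N
    unfold WN ramp
    rw [this]
    split_ifs with h
    · have h1 : ⌊s⌋₊ ≤ N := Nat.floor_le_of_le (by exact_mod_cast hsN)
      have h2 : ⌊s⌋₊ = N := le_antisymm h1 h
      have h3 : s = N := le_antisymm hsN (by rw [← h2]; exact Nat.floor_le hs0.le)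
      rw [h2, h3]; ring
    · rfl
  set k := ⌊s⌋₊ with hk
  have hk1 : (k:ℝ) ≤ s := Nat.floor_le hs0.le
  have hk2 : s < k + 1 := Nat.lt_floor_add_one s
  have hconv : ∀ E : ℝ, |W u y - FF W N k y| ≤ E → (k < s → |W u y - FF W N (k+1) y| ≤ E) →
      |W u y - WN W N u y| ≤ E := by
    intro E h1 h2
    rw [hWN]
    rcases hk1.eq_or_lt with h | h
    · rw [h]; simpa using h1
    · have h2 := h2 h
      have e : W u y - (FF W N k y + (FF W N (k+1) y - FF W N k y) * (s - k)) =
        (1 - (s-k)) * (W u y - FF W N k y) + (s-k) * (W u y - FF W N (k+1) y) := by ring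
      rw [e]
      refine (abs_add_le _ _).trans ?_
      rw [abs_mul, abs_mul, abs_of_nonneg (show 0 ≤ 1 - (s-k) by linarith), abs_of_nonneg (show 0 ≤ s - k by linarith)]
      nlinarith
  rcases Nat.eq_zero_or_pos k with h0 | hpos
  · have hs1 : s < 1 := by rw [h0] at hk2; simpa using hk2
    have h1 : 1 ≤ s ^ (-(5/6:ℝ)) := Real.one_le_rpow_of_pos_of_le_one_of_nonpos hs0 hs1.le (by norm_num)
    have h2 : ∀ a b : ℝ, |W a y - W b y| ≤ (2 * C + 2) * M * s ^ (-(5/6:ℝ)) := by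
      intro a b
      have h3 : |W a y - W b y| ≤ 2 * M := by
        have := abs_sub (W a y) (W b y)
        have := hW a y
        have := hW b y
        linarith
      have h4 : 2 * M ≤ (2 * C + 2) * M := by nlinarith
      exact h3.trans (h4.trans (le_mul_of_one_le_right (by positivity) h1))
    exact hconv _ (h2 _ _) fun _ => h2 _ _
  · have hkr : (1:ℝ) ≤ k := by exact_mod_cast hpos
    have hs1 : 1 ≤ s := hkr.trans hk1
    have hsr : 1 / s ≤ s ^ (-(5/6:ℝ)) := by
      rw [one_div, ← Real.rpow_neg_one]
      exact Real.rpow_le_rpow_of_exponent_le hs1 (by norm_num)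
    have hE : C * M * (2 / s) ≤ (2 * C + 2) * M * s ^ (-(5/6:ℝ)) := by
      have : C * M * (2 / s) = 2 * C * M * (1/s) := by ring
      rw [this]
      have h5 : 2 * C * M ≤ (2 * C + 2) * M := by nlinarith
      exact mul_le_mul h5 hsr (by positivity) (by positivity)
    refine (hconv (C * M * (2/s)) ?_ ?_).trans hE
    · unfold FF
      rw [max_eq_left hkr, abs_sub_comm]
      have hku : (k:ℝ)/N ≤ u := by rw [div_le_iff₀ hN0]; linarith
      refine (hreg _ _ y (by positivity) hku hu1).trans ?_
      apply mul_le_mul_of_nonneg_left _ (by positivity)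
      have : (u - k / N) / (k/N) = (s - k) / k := by rw [hs]; field_simp
      rw [this, div_le_div_iff₀ (by positivity) hs0]
      nlinarith
    · intro hlt
      unfold FF
      have hkN : (k:ℝ) + 1 ≤ N := by
        have : k < N := by
          have : (k:ℝ) < N := hlt.trans_le hsN
          exact_mod_cast this
        exact_mod_cast this
      push_cast
      rw [max_eq_left (by linarith)]
      have hku : u ≤ ((k:ℝ)+1)/N := by rw [le_div_iff₀ hN0]; linarith
      refine (hreg _ _ y hu0 hku (by rw [div_le_one hN0]; exact hkN)).trans ?_
      apply mul_le_mul_of_nonneg_left _ (by positivity)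
      have : (((k:ℝ)+1)/N - u) / u = (k + 1 - s) / s := by rw [hs]; field_simp
      rw [this]
      gcongr; linarith

lemma FF_diff (W : ℝ → ℝ → ℝ) (M C : ℝ) 
    (hreg : ∀ u u' y, 0 < u → u ≤ u' → u' ≤ 1 → |W u y - W u' y| ≤ C * M * ((u' - u) / u))
    (N q : ℕ) (hq : q < N) (y : ℝ) :
    |FF W N (q+1) y - FF W N q y| ≤ C * M * (1 / (q:ℝ)) := by
  have hN0 : (0:ℝ) < N := by exact_mod_cast (by omega : 0 < N)
  rcases Nat.eq_zero_or_pos q with h0 | hpos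
  · subst h0; simp [FF]
  · have hqr : (1:ℝ) ≤ q := by exact_mod_cast hpos
    have hqN : (q:ℝ) + 1 ≤ N := by exact_mod_cast hq
    unfold FF
    push_cast
    rw [max_eq_left (by linarith), max_eq_left hqr, abs_sub_comm]
    have hle : (q:ℝ)/N ≤ (q+1)/N := by gcongr; linarith
    refine (hreg _ _ y (by positivity) hle (by rw [div_le_one hN0]; exact hqN)).trans (le_of_eq ?_)
    congr 1
    field_simp
    ring

lemma harm_bound (N : ℕ) : ∑ q ∈ Finset.range N, 1 / (q:ℝ) ≤ 1 + Real.log N := by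
  cases N with
  | zero => simp
  | succ n =>
    rw [Finset.sum_range_succ']
    have h := harmonic_le_one_add_log n
    simp only [harmonic] at h
    push_cast at h ⊢
    simp only [one_div, div_zero, add_zero, inv_zero] at h ⊢
    refine h.trans ?_
    rcases Nat.eq_zero_or_pos n with h0 | hp
    · subst h0; simp
    · have : (0:ℝ) < n := by exact_mod_cast hp
      have := Real.log_le_log this (show (n:ℝ) ≤ n + 1 by linarith)
      linarith

lemma WN_decouple (μ : Measure ℝ) [IsProbabilityMeasure μ] (T : ℝ → ℝ) (hT : MeasurePreserving T μ μ)
    (r : ℕ → ℝ) (hr0 : ∀ ℓ, 0 ≤ r ℓ)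
    (hdecay : ∀ (v w : ℝ → ℝ) (Mv : ℝ) (Lw : NNReal), Measurable v → (∀ x, |v x| ≤ Mv) →
      Continuous w → LipschitzOnWith Lw w (Icc (0:ℝ) 1) →
      ∀ ℓ : ℕ, 1 ≤ ℓ →
        |(∫ x, v (T^[ℓ] x) * w x ∂μ) - (∫ x, v x ∂μ) * (∫ x, w x ∂μ)| ≤ Mv * (Lw : ℝ) * r ℓ)
    (W : ℝ → ℝ → ℝ) (hWm : Measurable (Function.uncurry W))
    (M C : ℝ) (hC : 0 ≤ C) (hW : ∀ u y, |W u y| ≤ M)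
    (hreg : ∀ u u' y, 0 < u → u ≤ u' → u' ≤ 1 → |W u y - W u' y| ≤ C * M * ((u' - u) / u))
    (N : ℕ) (ℓ : ℕ) (hℓ : 1 ≤ ℓ) :
    |(∫ u, WN W N u (T^[ℓ] u) ∂μ) - ∫ y, ∫ u, WN W N u y ∂μ ∂μ| ≤ C * M * (1 + Real.log N) * (N * r ℓ) := by
  have hM0 : 0 ≤ M := (abs_nonneg _).trans (hW 0 0)
  have hFm : ∀ q, Measurable (FF W N q) := fun q => hWm.comp (measurable_prodMk_left)
  have hTl := hT.iterate ℓ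
  set v : ℕ → ℝ → ℝ := fun q y => FF W N (q+1) y - FF W N q y with hv
  have hvm : ∀ q, Measurable (v q) := fun q => (hFm _).sub (hFm _)
  have hFi : ∀ q, Integrable (FF W N q) μ := fun q =>
    Integrable.of_bound (hFm q).aestronglyMeasurable M (ae_of_all _ fun y => hW _ _)
  have hvi : ∀ q, Integrable (v q) μ := fun q => (hFi _).sub (hFi _)
  have hri : ∀ q, Integrable (ramp N q) μ := fun q =>
    Integrable.of_bound (ramp_continuous N q).aestronglyMeasurable 1 (ae_of_all _ fun y => ramp_bound _ _ _)
  have hvTi : ∀ q, Integrable (fun u => v q (T^[ℓ] u) * ramp N q u) μ := fun q =>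
    (hTl.integrable_comp_of_integrable (hvi q)).mul_bdd (c := 1) (ramp_continuous N q).aestronglyMeasurable
      (ae_of_all _ fun y => ramp_bound _ _ _)
  have e1 : ∫ u, WN W N u (T^[ℓ] u) ∂μ =
      (∫ y, FF W N 0 y ∂μ) + ∑ q ∈ Finset.range N, ∫ u, v q (T^[ℓ] u) * ramp N q u ∂μ := by
    have hF0 : Integrable (fun u => FF W N 0 (T^[ℓ] u)) μ := hTl.integrable_comp_of_integrable (hFi 0)
    change ∫ u, (FF W N 0 (T^[ℓ] u) + ∑ q ∈ Finset.range N, v q (T^[ℓ] u) * ramp N q u) ∂μ = _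
    rw [integral_add hF0 (integrable_finsetSum _ fun q _ => hvTi q),
      integral_finsetSum _ fun q _ => hvTi q]
    congr 1
    have := integral_map (μ := μ) hTl.measurable.aemeasurable (f := FF W N 0) (hFm 0).aestronglyMeasurable
    rw [hTl.map_eq] at this
    exact this.symm
  have e2 : ∫ y, ∫ u, WN W N u y ∂μ ∂μ =
      (∫ y, FF W N 0 y ∂μ) + ∑ q ∈ Finset.range N, (∫ y, v q y ∂μ) * ∫ u, ramp N q u ∂μ := by
    have : ∀ y, ∫ u, WN W N u y ∂μ = FF W N 0 y + ∑ q ∈ Finset.range N, v q y * ∫ u, ramp N q u ∂μ := by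
      intro y
      unfold WN
      rw [integral_add (integrable_const _) (integrable_finsetSum _ fun q _ => (hri q).const_mul _),
        integral_finsetSum _ fun q _ => (hri q).const_mul _]
      simp [integral_const_mul, hv]
    simp_rw [this]
    rw [integral_add (hFi 0) (integrable_finsetSum _ fun q _ => (hvi q).mul_const _),
        integral_finsetSum _ fun q _ => (hvi q).mul_const _]
    simp [integral_mul_const]
  rw [e1, e2, add_sub_add_left_eq_sub, ← Finset.sum_sub_distrib]
  refine (Finset.abs_sum_le_sum_abs _ _).trans ?_
  calc _ ≤ ∑ q ∈ Finset.range N, C * M * (1 / (q:ℝ)) * (N * r ℓ) := by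
        apply Finset.sum_le_sum
        intro q hq
        have := hdecay (v q) (ramp N q) (C * M * (1 / (q:ℝ))) (N : NNReal) (hvm q)
          (fun y => FF_diff W M C hreg N q (Finset.mem_range.1 hq) y) (ramp_continuous N q)
          ((ramp_lip N q).lipschitzOnWith) ℓ hℓ
        simpa [mul_assoc] using this
    _ = C * M * (∑ q ∈ Finset.range N, 1 / (q:ℝ)) * (N * r ℓ) := by
        rw [Finset.mul_sum, Finset.sum_mul]
    _ ≤ _ := by
        have := harm_bound N
        have := hr0 ℓ
        gcongr

lemma decouple (μ : Measure ℝ) [IsProbabilityMeasure μ] (T : ℝ → ℝ) (hT : MeasurePreserving T μ μ)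
    (hsupp : ∀ᵐ x ∂μ, x ∈ Ioc (0:ℝ) 1) (hintg : Integrable (fun u : ℝ => u ^ (-(5/6:ℝ))) μ)
    (C₀ : ℝ) (hC₀ : 0 < C₀)
    (hdecay : ∀ (v w : ℝ → ℝ) (Mv : ℝ) (Lw : NNReal), Measurable v → (∀ x, |v x| ≤ Mv) →
      Continuous w → LipschitzOnWith Lw w (Icc (0:ℝ) 1) →
      ∀ ℓ : ℕ, 1 ≤ ℓ →
        |(∫ x, v (T^[ℓ] x) * w x ∂μ) - (∫ x, v x ∂μ) * (∫ x, w x ∂μ)| ≤ Mv * (Lw : ℝ) * (C₀ * (ℓ:ℝ)^(-6:ℝ)))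
    (C : ℝ) (hC : 0 ≤ C) :
    ∃ Cf : ℝ, 0 < Cf ∧ ∀ (W : ℝ → ℝ → ℝ) (M : ℝ), Measurable (Function.uncurry W) →
      (∀ u y, |W u y| ≤ M) →
      (∀ u u' y, 0 < u → u ≤ u' → u' ≤ 1 → |W u y - W u' y| ≤ C * M * ((u' - u) / u)) →
      ∀ ℓ : ℕ, 1 ≤ ℓ → 
      |(∫ u, W u (T^[ℓ] u) ∂μ) - ∫ y, ∫ u, W u y ∂μ ∂μ| ≤ Cf * M * (ℓ:ℝ)^(-(5/2):ℝ) := by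
  set I : ℝ := ∫ u, u ^ (-(5/6:ℝ)) ∂μ with hI
  have hI0 : 0 ≤ I := integral_nonneg_of_ae (hsupp.mono fun u hu => Real.rpow_nonneg hu.1.le _)
  refine ⟨2 * ((2 * C + 2) * I) + C * 7 * C₀ + 1, by positivity, ?_⟩
  intro W M hWm hW hreg ℓ hℓ
  have hM0 : 0 ≤ M := (abs_nonneg _).trans (hW 0 0)
  set N := ℓ^3 with hN
  have hN1 : 1 ≤ N := Nat.one_le_pow _ _ hℓ
  have hℓ0 : (0:ℝ) < ℓ := by exact_mod_cast hℓ
  have hℓ1 : (1:ℝ) ≤ ℓ := by exact_mod_cast hℓ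
  have hTl := hT.iterate ℓ
  have hFm : ∀ q, Measurable (FF W N q) := fun q => hWm.comp (measurable_prodMk_left)
  have hWNm : Measurable (Function.uncurry (WN W N)) := by
    unfold WN Function.uncurry
    apply Measurable.add
    · exact (hFm 0).comp measurable_snd
    · apply Finset.measurable_sum
      intro q _
      exact (((hFm _).comp measurable_snd).sub ((hFm _).comp measurable_snd)).mul
        ((ramp_continuous N q).measurable.comp measurable_fst)
  set E : ℝ → ℝ := fun u => (2 * C + 2) * M * ((N:ℝ) ^ (-(5/6:ℝ)) * u ^ (-(5/6:ℝ))) with hE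
  have hEi : Integrable E μ := (hintg.const_mul _).const_mul _
  have hNr : (N:ℝ) ^ (-(5/6:ℝ)) = (ℓ:ℝ)^(-(5/2):ℝ) := by
    rw [hN]; push_cast
    rw [← Real.rpow_natCast, ← Real.rpow_mul hℓ0.le]; norm_num
  have hEI : ∫ u, E u ∂μ = (2 * C + 2) * I * M * (ℓ:ℝ)^(-(5/2):ℝ) := by
    simp only [hE, integral_const_mul]
    rw [hNr]; ring
  have happ : ∀ᵐ u ∂μ, ∀ y, |W u y - WN W N u y| ≤ E u := by
    filter_upwards [hsupp] with u hu y
    exact WN_approx W M C hC hW hreg N hN1 u y hu.1 hu.2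
  -- integrability
  have hWi : ∀ (g : ℝ → ℝ), Measurable g → Integrable (fun u => W u (g u)) μ := fun g hg =>
    Integrable.of_bound (hWm.comp (measurable_id.prodMk hg)).aestronglyMeasurable M (ae_of_all _ fun u => hW _ _)
  have hFb : ∀ q y, |FF W N q y| ≤ M := fun q y => hW _ _
  have hWNb : ∀ u y, |WN W N u y| ≤ M + ∑ q ∈ Finset.range N, 2 * M := by
    intro u y
    unfold WN
    refine (abs_add_le _ _).trans (add_le_add (hFb _ _) ?_)
    refine (Finset.abs_sum_le_sum_abs _ _).trans (Finset.sum_le_sum fun q _ => ?_)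
    rw [abs_mul]
    have h1 := abs_sub (FF W N (q+1) y) (FF W N q y)
    have h2 := hFb (q+1) y
    have h3 := hFb q y
    calc _ ≤ (2 * M) * 1 := mul_le_mul (by linarith) (ramp_bound _ _ _) (abs_nonneg _) (by linarith)
      _ = _ := by ring
  have hWNi : ∀ (g : ℝ → ℝ), Measurable g → Integrable (fun u => WN W N u (g u)) μ := fun g hg =>
    Integrable.of_bound (hWNm.comp (measurable_id.prodMk hg)).aestronglyMeasurable _ (ae_of_all _ fun u => hWNb _ _)
  have hdiff : ∀ (g : ℝ → ℝ), Measurable g →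
      |(∫ u, W u (g u) ∂μ) - ∫ u, WN W N u (g u) ∂μ| ≤ (2 * C + 2) * I * M * (ℓ:ℝ)^(-(5/2):ℝ) := by
    intro g hg
    rw [← integral_sub (hWi g hg) (hWNi g hg), ← hEI]
    refine (abs_integral_le_integral_abs).trans ?_
    exact integral_mono_ae ((hWi g hg).sub (hWNi g hg)).abs hEi (happ.mono fun u hu => hu _)
  have h1 := hdiff (T^[ℓ]) hTl.measurable
  have h2 : |(∫ y, ∫ u, WN W N u y ∂μ ∂μ) - ∫ y, ∫ u, W u y ∂μ ∂μ| ≤ (2 * C + 2) * I * M * (ℓ:ℝ)^(-(5/2):ℝ) := by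
    have hm1 : Integrable (fun y => ∫ u, WN W N u y ∂μ) μ := by
      refine Integrable.of_bound (C := M + ∑ q ∈ Finset.range N, 2 * M) ?_ (ae_of_all _ fun y => ?_)
      · exact (hWNm.stronglyMeasurable.integral_prod_left').aestronglyMeasurable
      · simpa using norm_integral_le_of_norm_le_const (μ := μ) (f := fun u => WN W N u y) (ae_of_all _ fun u => hWNb u y)
    have hm2 : Integrable (fun y => ∫ u, W u y ∂μ) μ := by
      refine Integrable.of_bound (C := M) ?_ (ae_of_all _ fun y => ?_)
      · exact (hWm.stronglyMeasurable.integral_prod_left').aestronglyMeasurable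
      · simpa using norm_integral_le_of_norm_le_const (μ := μ) (f := fun u => W u y) (ae_of_all _ fun u => hW u y)
    rw [← integral_sub hm1 hm2]
    have := norm_integral_le_of_norm_le_const (μ := μ) (f := fun y => (∫ u, WN W N u y ∂μ) - ∫ u, W u y ∂μ)
      (C := (2 * C + 2) * I * M * (ℓ:ℝ)^(-(5/2):ℝ)) (ae_of_all _ fun y => by
        rw [Real.norm_eq_abs, abs_sub_comm]; exact hdiff (fun _ => y) measurable_const)
    simpa using this
  have h3 := WN_decouple μ T hT (fun ℓ => C₀ * (ℓ:ℝ)^(-6:ℝ)) (fun ℓ => by positivity) hdecay W hWm M C hC hW hreg N ℓ hℓ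
  have h4 : C * M * (1 + Real.log N) * (N * (C₀ * (ℓ:ℝ)^(-6:ℝ))) ≤ C * 7 * C₀ * M * (ℓ:ℝ)^(-(5/2):ℝ) := by
    have hl : Real.log ℓ ≤ 2 * (ℓ:ℝ)^(1/2:ℝ) := by
      have := Real.log_le_rpow_div hℓ0.le (show (0:ℝ) < 1/2 by norm_num)
      linarith
    have hl1 : 1 ≤ (ℓ:ℝ)^(1/2:ℝ) := Real.one_le_rpow hℓ1 (by norm_num)
    have hl2 : 1 + Real.log N ≤ 7 * (ℓ:ℝ)^(1/2:ℝ) := by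
      rw [hN]; push_cast; rw [Real.log_pow]; push_cast; linarith
    have e : (ℓ:ℝ)^(1/2:ℝ) * (N * (ℓ:ℝ)^(-6:ℝ)) = (ℓ:ℝ)^(-(5/2):ℝ) := by
      rw [hN]; push_cast
      rw [← Real.rpow_natCast, ← Real.rpow_add hℓ0, ← Real.rpow_add hℓ0]; norm_num
    calc _ ≤ C * M * (7 * (ℓ:ℝ)^(1/2:ℝ)) * (N * (C₀ * (ℓ:ℝ)^(-6:ℝ))) := by gcongr
      _ = C * 7 * C₀ * M * ((ℓ:ℝ)^(1/2:ℝ) * (N * (ℓ:ℝ)^(-6:ℝ))) := by ring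
      _ = _ := by rw [e]
  have h5 : 0 ≤ M * (ℓ:ℝ)^(-(5/2):ℝ) := by positivity
  have := abs_le.1 h1
  have := abs_le.1 h2
  have := abs_le.1 h3
  rw [abs_le]; constructor <;> nlinarith

end VarIneq

open MeasureTheory Set

namespace VarIneq

section mix
variable {ι : Type} [Fintype ι]

noncomputable def mixp (q : ι → ℝ → ℝ) (a : ι) (u : ℝ) : ℝ := q a u / ∑ b, q b u

lemma mixp_nonneg (q : ι → ℝ → ℝ) (hq0 : ∀ a x, 0 ≤ q a x) (a : ι) (u : ℝ) : 0 ≤ mixp q a u :=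
  div_nonneg (hq0 _ _) (Finset.sum_nonneg fun _ _ => hq0 _ _)

lemma mixp_sum (q : ι → ℝ → ℝ) (u : ℝ) : ∑ a, mixp q a u ≤ 1 := by
  unfold mixp
  rw [← Finset.sum_div]
  exact div_self_le_one _

lemma mixp_mul (q : ι → ℝ → ℝ) (hq0 : ∀ a x, 0 ≤ q a x) (a : ι) (u : ℝ) :
    mixp q a u * ∑ b, q b u = q a u := by
  unfold mixp
  by_cases h : ∑ b, q b u = 0
  · rw [h, mul_zero]
    exact ((Finset.sum_eq_zero_iff_of_nonneg (fun b _ => hq0 b u)).1 h a (Finset.mem_univ a)).symm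
  · field_simp

lemma mixp_ratio (A : ℝ) (q : ι → ℝ → ℝ) (hq0 : ∀ a x, 0 ≤ q a x)
    (hqc : ∀ a, ∀ x ∈ Ioc (0:ℝ) 1, ∀ y ∈ Ioc (0:ℝ) 1, q a x ≤ q a y * Real.exp (dd A x y))
    (a : ι) (u u' : ℝ) (hu : u ∈ Ioc (0:ℝ) 1) (hu' : u' ∈ Ioc (0:ℝ) 1) :
    mixp q a u ≤ mixp q a u' * Real.exp (2 * dd A u u') := by
  set e := Real.exp (dd A u u') with he
  have he0 : 0 < e := Real.exp_pos _
  have he2 : Real.exp (2 * dd A u u') = e * e := by rw [two_mul, Real.exp_add]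
  rw [he2]
  have hS : ∑ b, q b u' ≤ (∑ b, q b u) * e := by
    rw [Finset.sum_mul]
    refine Finset.sum_le_sum fun b _ => ?_
    rw [he, dd_comm]; exact hqc b u' hu' u hu
  have hS2 : ∑ b, q b u ≤ (∑ b, q b u') * e := by
    rw [Finset.sum_mul]
    exact Finset.sum_le_sum fun b _ => hqc b u hu u' hu'
  have hn : 0 ≤ ∑ b, q b u := Finset.sum_nonneg fun _ _ => hq0 _ _
  rcases hn.eq_or_lt with h | h
  · have : mixp q a u = 0 := by unfold mixp; rw [← h, div_zero]
    rw [this]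
    have := mixp_nonneg q hq0 a u'
    positivity
  · have h' : 0 < ∑ b, q b u' := by
      by_contra hc
      push Not at hc
      nlinarith
    unfold mixp
    rw [div_mul_eq_mul_div, div_le_div_iff₀ h h']
    calc q a u * ∑ b, q b u' ≤ (q a u' * e) * ((∑ b, q b u) * e) :=
          mul_le_mul (hqc a u hu u' hu') hS h'.le (mul_nonneg (hq0 _ _) he0.le)
      _ = _ := by ring

lemma mixp_reg (A : ℝ) (hA : 0 ≤ A) (q : ι → ℝ → ℝ) (hq0 : ∀ a x, 0 ≤ q a x)
    (hqc : ∀ a, ∀ x ∈ Ioc (0:ℝ) 1, ∀ y ∈ Ioc (0:ℝ) 1, q a x ≤ q a y * Real.exp (dd A x y))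
    (V : ι → ℝ) (M : ℝ) (hM : 0 ≤ M) (hV : ∀ a, |V a| ≤ M) (u u' : ℝ) (hu : 0 < u) (huu : u ≤ u') (hu' : u' ≤ 1) :
    |∑ a, mixp q a u * V a - ∑ a, mixp q a u' * V a| ≤ (8 * (A + 2)) * M * ((u' - u) / u) := by
  set t := (u' - u) / u with ht
  have ht0 : 0 ≤ t := div_nonneg (by linarith) hu.le
  have hb : ∀ v, |∑ a, mixp q a v * V a| ≤ M := by
    intro v
    calc _ ≤ ∑ a, mixp q a v * M := by
          refine (Finset.abs_sum_le_sum_abs _ _).trans (Finset.sum_le_sum fun a _ => ?_)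
          rw [abs_mul, abs_of_nonneg (mixp_nonneg q hq0 a v)]
          exact mul_le_mul_of_nonneg_left (hV a) (mixp_nonneg q hq0 a v)
      _ ≤ M := by
          rw [← Finset.sum_mul]
          exact mul_le_of_le_one_left hM (mixp_sum q v)
  set δ := 2 * ((A + 2) * t) with hδ
  have hδ0 : 0 ≤ δ := by positivity
  have hgoal : (8 * (A + 2)) * M * t = 4 * δ * M := by rw [hδ]; ring
  rw [hgoal]
  rcases le_or_gt δ 1 with h1 | h1
  · have hdd : dd A u u' ≤ (A + 2) * t := by
      unfold dd
      have htu : t * u = u' - u := by rw [ht]; field_simp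
      have e1 : |u - u'| ≤ t := by
        rw [abs_sub_comm, abs_of_nonneg (by linarith)]
        nlinarith
      have e2 : |Real.log u - Real.log u'| ≤ t := by
        have hl := Real.log_le_log hu huu
        rw [abs_sub_comm, abs_of_nonneg (by linarith), ← Real.log_div (by linarith) hu.ne']
        refine (Real.log_le_sub_one_of_pos (by have : 0 < u' := by linarith
                                               positivity)).trans (le_of_eq ?_)
        rw [ht]; field_simp
      nlinarith
    have hem : Real.exp (2 * dd A u u') ≤ 1 + 2 * δ := by
      have h2 : Real.exp (2 * dd A u u') ≤ Real.exp δ := Real.exp_le_exp.2 (by rw [hδ]; linarith)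
      have h3 := Real.abs_exp_sub_one_le (x := δ) (by rw [abs_of_nonneg hδ0]; exact h1)
      rw [abs_of_nonneg hδ0] at h3
      have := (abs_le.1 h3).2
      linarith
    have hum : u ∈ Ioc (0:ℝ) 1 := ⟨hu, huu.trans hu'⟩
    have hum' : u' ∈ Ioc (0:ℝ) 1 := ⟨hu.trans_le huu, hu'⟩
    have hpa : ∀ a, |mixp q a u - mixp q a u'| ≤ 2 * δ * (mixp q a u + mixp q a u') := by
      intro a
      have r1 := mixp_ratio A q hq0 hqc a u u' hum hum'
      have r2 := mixp_ratio A q hq0 hqc a u' u hum' hum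
      rw [dd_comm] at r2
      have n1 := mixp_nonneg q hq0 a u
      have n2 := mixp_nonneg q hq0 a u'
      have s1 := mul_le_mul_of_nonneg_left hem n1
      have s2 := mul_le_mul_of_nonneg_left hem n2
      have t1 := mul_nonneg hδ0 n1
      have t2 := mul_nonneg hδ0 n2
      rw [abs_le]; constructor <;> nlinarith
    rw [← Finset.sum_sub_distrib]
    calc _ ≤ ∑ a, 2 * δ * (mixp q a u + mixp q a u') * M := by
          refine (Finset.abs_sum_le_sum_abs _ _).trans (Finset.sum_le_sum fun a _ => ?_)
          rw [← sub_mul, abs_mul]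
          have := mixp_nonneg q hq0 a u
          have := mixp_nonneg q hq0 a u'
          exact mul_le_mul (hpa a) (hV a) (abs_nonneg _) (by positivity)
      _ = 2 * δ * (∑ a, mixp q a u + ∑ a, mixp q a u') * M := by
          rw [← Finset.sum_mul, ← Finset.mul_sum, Finset.sum_add_distrib]
      _ ≤ 2 * δ * (1 + 1) * M := by
          have := mixp_sum q u
          have := mixp_sum q u'
          gcongr
      _ = _ := by ring
  · have := hb u
    have := hb u'
    have := abs_sub (∑ a, mixp q a u * V a) (∑ a, mixp q a u' * V a)
    nlinarith

end mix

noncomputable def itin (T : ℝ → ℝ) (J : ℕ) (x : ℝ) : Fin J → Bool := fun i => decide (T^[(i:ℕ)] x < 1/2)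

def ext {J : ℕ} (a : Fin J → Bool) (i : ℕ) : Bool := if h : i < J then a ⟨i, h⟩ else true

lemma itin_preimage (T : ℝ → ℝ) (J : ℕ) (a : Fin J → Bool) : itin T J ⁻¹' {a} = cyl T J (ext a) := by
  ext x
  simp only [mem_preimage, mem_singleton_iff, cyl, mem_setOf_eq, funext_iff, itin]
  constructor
  · intro h i hi
    have := h ⟨i, hi⟩
    simp only [ext, hi, dite_true, ← this, side]
    by_cases hx : T^[i] x < 1/2
    · rw [if_pos (by simpa using hx)]; exact hx
    · rw [if_neg (by simpa using hx)]; exact not_lt.1 hx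
  · intro h i
    have := h i i.2
    simp only [ext, i.2, dite_true, side, Fin.eta] at this
    cases ha : a i <;> simp [ha] at this ⊢ <;> assumption

lemma measurable_itin (T : ℝ → ℝ) (hT : Measurable T) (J : ℕ) : Measurable (itin T J) := by
  refine measurable_to_countable' fun a => ?_
  rw [itin_preimage]; exact measurableSet_cyl T hT J _

lemma cyl_integral (A : ℝ) (T : ℝ → ℝ) (hT : Measurable T) (ν : Measure ℝ) [IsProbabilityMeasure ν] (J : ℕ)
    (q : (Fin J → Bool) → ℝ → ℝ) (hqm : ∀ a, Measurable (q a)) (hq0 : ∀ a x, 0 ≤ q a x)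
    (hqe : ∀ a, (ν.restrict (cyl T J (ext a))).map T^[J] =
      (volume.restrict (Ioc 0 1)).withDensity (fun x => ENNReal.ofReal (q a x)))
    (G : (Fin J → Bool) → ℝ → ℝ) (hG : ∀ a, Measurable (G a)) (M : ℝ) (hGM : ∀ a x, |G a x| ≤ M) :
    ∫ x, G (itin T J x) (T^[J] x) ∂ν = ∫ u in Ioc (0:ℝ) 1, ∑ a, q a u * G a u := by
  have hm : ∀ a, MeasurableSet (itin T J ⁻¹' {a}) := fun a => by
    rw [itin_preimage]; exact measurableSet_cyl T hT J _
  have hGi : ∀ a, Integrable (fun x => G a (T^[J] x)) ν := fun a =>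
    Integrable.of_bound ((hG a).comp (hT.iterate J)).aestronglyMeasurable M (ae_of_all _ fun x => hGM _ _)
  have huniv : (⋃ a, itin T J ⁻¹' {a}) = univ := by
    ext x; simp
  have h1 : ∫ x, G (itin T J x) (T^[J] x) ∂ν = ∑ a, ∫ x in itin T J ⁻¹' {a}, G (itin T J x) (T^[J] x) ∂ν := by
    rw [← integral_iUnion_fintype hm, huniv, setIntegral_univ]
    · intro a b hab
      refine Disjoint.preimage _ ?_
      simpa using hab
    · intro a
      refine ((hGi a).integrableOn).congr_fun (fun x hx => ?_) (hm a)
      simp only [mem_preimage, mem_singleton_iff] at hx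
      simp only [hx]
  have h2 : ∀ a, ∫ x in itin T J ⁻¹' {a}, G (itin T J x) (T^[J] x) ∂ν =
      ∫ u in Ioc (0:ℝ) 1, q a u * G a u := by
    intro a
    have : ∫ x in itin T J ⁻¹' {a}, G (itin T J x) (T^[J] x) ∂ν = ∫ x in itin T J ⁻¹' {a}, G a (T^[J] x) ∂ν := by
      refine setIntegral_congr_fun (hm a) fun x hx => ?_
      simp only [mem_preimage, mem_singleton_iff] at hx
      simp only [hx]
    rw [this, itin_preimage, ← integral_map (hT.iterate J).aemeasurable (hG a).aestronglyMeasurable, hqe,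
      integral_withDensity_eq_integral_toReal_smul (hqm a).ennreal_ofReal (ae_of_all _ fun _ => ENNReal.ofReal_lt_top)]
    refine integral_congr_ae (ae_of_all _ fun u => ?_)
    simp [ENNReal.toReal_ofReal (hq0 a u)]
  have h3 : ∀ a, Integrable (fun u => q a u * G a u) (volume.restrict (Ioc (0:ℝ) 1)) := by
    intro a
    have : Integrable (G a) ((volume.restrict (Ioc 0 1)).withDensity (fun x => ENNReal.ofReal (q a x))) := by
      rw [← hqe]
      exact Integrable.of_bound (hG a).aestronglyMeasurable M (ae_of_all _ fun x => hGM _ _)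
    rw [integrable_withDensity_iff_integrable_smul' (hqm a).ennreal_ofReal (ae_of_all _ fun _ => ENNReal.ofReal_lt_top)] at this
    refine this.congr (ae_of_all _ fun u => ?_)
    simp [ENNReal.toReal_ofReal (hq0 a u)]
  rw [h1, integral_finsetSum _ fun a _ => h3 a]
  exact Finset.sum_congr rfl fun a _ => h2 a

lemma main_lemma (A : ℝ) (hA : 0 ≤ A) (μ : Measure ℝ) [IsProbabilityMeasure μ] (T : ℝ → ℝ)
    (hT : MeasurePreserving T μ μ)
    (hsupp : ∀ᵐ x ∂μ, x ∈ Ioc (0:ℝ) 1)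
    (hb : ∀ b ν, Reg A ν → Reg A ((ν.restrict (side b)).map T))
    (happ : ∀ ε : ℝ, 0 < ε → ∃ ν : Measure ℝ, IsProbabilityMeasure ν ∧ Reg A ν ∧ ∀ v : ℝ → ℝ, Measurable v → (∀ x, |v x| ≤ 1) →
      |∫ x, v x ∂ν - ∫ x, v x ∂μ| ≤ ε)
    (Cf : ℝ)
    (hdec : ∀ (W : ℝ → ℝ → ℝ) (M : ℝ), Measurable (Function.uncurry W) →
      (∀ u y, |W u y| ≤ M) →
      (∀ u u' y, 0 < u → u ≤ u' → u' ≤ 1 → |W u y - W u' y| ≤ (8 * (A + 2)) * M * ((u' - u) / u)) →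
      ∀ ℓ : ℕ, 1 ≤ ℓ → 
      |(∫ u, W u (T^[ℓ] u) ∂μ) - ∫ y, ∫ u, W u y ∂μ ∂μ| ≤ Cf * M * (ℓ:ℝ)^(-(5/2):ℝ))
    (H : ℝ → ℝ → ℝ) (hHm : Measurable (Function.uncurry H)) (M ω : ℝ) (hHM : ∀ x y, |H x y| ≤ M)
    (J : ℕ)
    (hω : ∀ x ∈ Icc (0:ℝ) 1, ∀ x' ∈ Icc (0:ℝ) 1, (∀ i < J, SameSide (T^[i] x) (T^[i] x')) → ∀ y, |H x y - H x' y| ≤ ω)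
    (ℓ : ℕ) (hℓ : 1 ≤ ℓ) :
    |(∫ x, H x (T^[J + ℓ] x) ∂μ) - ∫ y, ∫ x, H x y ∂μ ∂μ| ≤ 2 * ω + Cf * M * (ℓ:ℝ)^(-(5/2):ℝ) := by
  classical
  have hTm := hT.measurable
  have hM0 : 0 ≤ M := (abs_nonneg _).trans (hHM 0 0)
  have hTJ := hT.iterate J
  have hTl := hT.iterate ℓ
  -- representatives
  set rep : (Fin J → Bool) → ℝ := fun a =>
    if h : ∃ x ∈ Icc (0:ℝ) 1, itin T J x = a then h.choose else 0 with hrep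
  have hrep1 : ∀ x ∈ Icc (0:ℝ) 1, ∀ y, |H x y - H (rep (itin T J x)) y| ≤ ω := by
    intro x hx y
    have hex : ∃ x' ∈ Icc (0:ℝ) 1, itin T J x' = itin T J x := ⟨x, hx, rfl⟩
    have e : rep (itin T J x) = hex.choose := by simp only [hrep, dif_pos hex]
    rw [e]
    obtain ⟨h1, h2⟩ := hex.choose_spec
    refine hω _ hx _ h1 (fun i hi => ?_) y
    have := congrFun h2 ⟨i, hi⟩
    simp only [itin, decide_eq_decide] at this
    exact this.symm
  set Hb : ℝ → ℝ → ℝ := fun x y => H (rep (itin T J x)) y with hHb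
  have hHbm : Measurable (Function.uncurry Hb) := by
    have : Measurable (fun p : (Fin J → Bool) × ℝ => H (rep p.1) p.2) :=
      measurable_from_prod_countable_right fun a =>
        (hHm.comp measurable_prodMk_left : Measurable (Function.uncurry H ∘ Prod.mk (rep a)))
    exact this.comp (((measurable_itin T hTm J).comp measurable_fst).prodMk measurable_snd)
  have hHbM : ∀ x y, |Hb x y| ≤ M := fun x y => hHM _ _
  have hsupp' : ∀ᵐ x ∂μ, x ∈ Icc (0:ℝ) 1 := hsupp.mono fun x hx => ⟨hx.1.le, hx.2⟩
  have hbi : ∀ (G : ℝ → ℝ → ℝ), Measurable (Function.uncurry G) → (∀ x y, |G x y| ≤ M) →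
      ∀ g : ℝ → ℝ, Measurable g → Integrable (fun x => G x (g x)) μ := fun G hG hGM g hg =>
    Integrable.of_bound (hG.comp (measurable_id.prodMk hg)).aestronglyMeasurable M (ae_of_all _ fun u => hGM _ _)
  have hbi2 : ∀ (G : ℝ → ℝ → ℝ), Measurable (Function.uncurry G) → (∀ x y, |G x y| ≤ M) →
      Integrable (fun y => ∫ x, G x y ∂μ) μ := by
    intro G hG hGM
    refine Integrable.of_bound (C := M) ?_ (ae_of_all _ fun y => ?_)
    · exact (hG.stronglyMeasurable.integral_prod_left').aestronglyMeasurable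
    · simpa using norm_integral_le_of_norm_le_const (μ := μ) (f := fun u => G u y) (ae_of_all _ fun u => hGM u y)
  have hdd : ∀ (G G' : ℝ → ℝ → ℝ), Measurable (Function.uncurry G) → (∀ x y, |G x y| ≤ M) →
      Measurable (Function.uncurry G') → (∀ x y, |G' x y| ≤ M) → ∀ E : ℝ,
      (∀ y, |(∫ x, G x y ∂μ) - ∫ x, G' x y ∂μ| ≤ E) → 
      |(∫ y, ∫ x, G x y ∂μ ∂μ) - ∫ y, ∫ x, G' x y ∂μ ∂μ| ≤ E := by
    intro G G' h1 h2 h3 h4 E hE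
    rw [← integral_sub (hbi2 G h1 h2) (hbi2 G' h3 h4)]
    have := norm_integral_le_of_norm_le_const (μ := μ) (f := fun y => (∫ x, G x y ∂μ) - ∫ x, G' x y ∂μ) (ae_of_all _ hE)
    simpa using this
  have hs : ∀ g : ℝ → ℝ, Measurable g → |(∫ x, H x (g x) ∂μ) - ∫ x, Hb x (g x) ∂μ| ≤ ω := by
    intro g hg
    rw [← integral_sub (hbi H hHm hHM g hg) (hbi Hb hHbm hHbM g hg)]
    have := norm_integral_le_of_norm_le_const (μ := μ) (f := fun x => H x (g x) - Hb x (g x)) (C := ω)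
      (hsupp'.mono fun x hx => hrep1 x hx _)
    simpa using this
  have hs1 := hs _ (hT.iterate (J + ℓ)).measurable
  have hs2 := hdd H Hb hHm hHM hHbm hHbM ω fun y => hs (fun _ => y) measurable_const
  apply le_of_forall_pos_le_add
  intro ε' hε'
  obtain ⟨ν, hνp, hνR, hν⟩ := happ (ε' / (4 * M + 1)) (by positivity)
  set ε := ε' / (4 * M + 1) with hε
  have hε4 : 4 * (M * ε) ≤ ε' := by
    have h0 : 0 < ε := by positivity
    have : ε * (4 * M + 1) = ε' := by rw [hε]; field_simp
    nlinarith
  have hνM : ∀ v : ℝ → ℝ, Measurable v → (∀ x, |v x| ≤ M) → |∫ x, v x ∂ν - ∫ x, v x ∂μ| ≤ M * ε := by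
    intro v hv hvM
    rcases hM0.eq_or_lt with h0 | h0
    · have : v = fun _ => 0 := by
        funext x
        have := hvM x
        rw [← h0] at this
        exact abs_nonpos_iff.1 this
      rw [this, ← h0]; simp
    · have := hν (fun x => v x / M) (hv.div_const M) (fun x => by
        rw [abs_div, abs_of_pos h0, div_le_one h0]; exact hvM x)
      rw [integral_div, integral_div, ← sub_div, abs_div, abs_of_pos h0, div_le_iff₀ h0] at this
      linarith
  choose q hqm hq0 hqc hqe using fun a : Fin J → Bool => reg_cyl A T hTm hb ν hνR (ext a) J
  set W : ℝ → ℝ → ℝ := fun u y => ∑ a, mixp q a u * H (rep a) y with hWdef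
  have hmixm : ∀ a, Measurable (mixp q a) := fun a => by
    unfold mixp
    exact (hqm a).div (Finset.measurable_sum _ fun b _ => hqm b)
  have hWm : Measurable (Function.uncurry W) := by
    apply Finset.measurable_sum
    intro a _
    exact ((hmixm a).comp measurable_fst).mul ((hHm.comp measurable_prodMk_left).comp measurable_snd)
  have hWM : ∀ u y, |W u y| ≤ M := by
    intro u y
    calc _ ≤ ∑ a, mixp q a u * M := by
          refine (Finset.abs_sum_le_sum_abs _ _).trans (Finset.sum_le_sum fun a _ => ?_)
          rw [abs_mul, abs_of_nonneg (mixp_nonneg q hq0 a u)]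
          exact mul_le_mul_of_nonneg_left (hHM _ _) (mixp_nonneg q hq0 a u)
      _ ≤ M := by
          rw [← Finset.sum_mul]
          exact mul_le_of_le_one_left hM0 (mixp_sum q u)
  have hWr := hdec W M hWm hWM (fun u u' y h1 h2 h3 =>
    mixp_reg A hA q hq0 hqc (fun a => H (rep a) y) M hM0 (fun a => hHM _ _) u u' h1 h2 h3) ℓ hℓ
  have hkey : ∀ g : ℝ → ℝ, Measurable g → ∫ x, Hb x (g (T^[J] x)) ∂ν = ∫ x, W (T^[J] x) (g (T^[J] x)) ∂ν := by
    intro g hg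
    have h1 := cyl_integral A T hTm ν J q hqm hq0 hqe (fun a u => H (rep a) (g u))
      (fun a => (hHm.comp measurable_prodMk_left).comp hg) M (fun _ _ => hHM _ _)
    have h2 := cyl_integral A T hTm ν J q hqm hq0 hqe (fun a u => W u (g u))
      (fun a => hWm.comp (measurable_id.prodMk hg)) M (fun _ _ => hWM _ _)
    refine h1.trans (Eq.trans ?_ h2.symm)
    refine integral_congr_ae (ae_of_all _ fun u => ?_)
    simp only [hWdef]
    rw [← Finset.sum_mul, Finset.mul_sum]
    refine Finset.sum_congr rfl fun a _ => ?_
    rw [← mixp_mul q hq0 a u]; ring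
  have hWinv : ∀ g : ℝ → ℝ, Measurable g → ∫ x, W (T^[J] x) (g (T^[J] x)) ∂μ = ∫ u, W u (g u) ∂μ := by
    intro g hg
    have := integral_map (μ := μ) hTJ.measurable.aemeasurable (f := fun u => W u (g u))
      (hWm.comp (measurable_id.prodMk hg)).aestronglyMeasurable
    rw [hTJ.map_eq] at this
    exact this.symm
  have hcmp : ∀ g : ℝ → ℝ, Measurable g → |(∫ x, Hb x (g (T^[J] x)) ∂μ) - ∫ u, W u (g u) ∂μ| ≤ 2 * (M * ε) := by
    intro g hg
    have hgJ : Measurable fun x => g (T^[J] x) := hg.comp hTJ.measurable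
    have h1 := hνM (fun x => Hb x (g (T^[J] x))) (hHbm.comp (measurable_id.prodMk hgJ)) (fun _ => hHbM _ _)
    have h2 := hνM (fun x => W (T^[J] x) (g (T^[J] x))) (hWm.comp (hTJ.measurable.prodMk hgJ)) (fun _ => hWM _ _)
    rw [hkey g hg] at h1
    rw [hWinv g hg] at h2
    have := abs_le.1 h1
    have := abs_le.1 h2
    rw [abs_le]; constructor <;> linarith
  have h1 := hcmp _ hTl.measurable
  have h2 := hdd Hb W hHbm hHbM hWm hWM _ fun y => hcmp (fun _ => y) measurable_const
  have e : ∀ x, T^[ℓ] (T^[J] x) = T^[J + ℓ] x := fun x => by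
    rw [← Function.iterate_add_apply, add_comm]
  simp only [e] at h1
  have := abs_le.1 h1
  have := abs_le.1 h2
  have := abs_le.1 hs1
  have := abs_le.1 hs2
  have := abs_le.1 hWr
  rw [abs_le]; constructor <;> linarith

end VarIneq

open MeasureTheory Set

namespace VarIneq

lemma pull {m m0 : MeasurableSpace ℝ} (μ : @Measure ℝ m0) [IsProbabilityMeasure μ] (hm : m ≤ m0)
    (ψ f : ℝ → ℝ) (hψ : StronglyMeasurable[m] ψ) (c : ℝ) (hψc : ∀ᵐ x ∂μ, |ψ x| ≤ c) (hf : Integrable f μ) :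
    ∫ x, ψ x * (μ[f | m]) x ∂μ = ∫ x, ψ x * f x ∂μ := by
  have hψf : Integrable (ψ * f) μ :=
    hf.bdd_mul (c := c) (hψ.mono hm).aestronglyMeasurable hψc
  have h1 := condExp_mul_of_stronglyMeasurable_left hψ hψf hf
  have h2 := integral_condExp (μ := μ) (f := ψ * f) hm
  rw [integral_congr_ae h1] at h2
  exact h2

/-- difference of conditional expectations -/
noncomputable def DD {m0 : MeasurableSpace ℝ} (μ : @Measure ℝ m0) (m1 m2 : MeasurableSpace ℝ) (f : ℝ → ℝ) (x : ℝ) : ℝ :=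
  (μ[f | m1]) x - (μ[f | m2]) x

lemma DD_sm {m0 : MeasurableSpace ℝ} (μ : @Measure ℝ m0) (m1 m2 : MeasurableSpace ℝ) (h21 : m2 ≤ m1)
    (f : ℝ → ℝ) : StronglyMeasurable[m1] (DD μ m1 m2 f) :=
  stronglyMeasurable_condExp.sub (stronglyMeasurable_condExp.mono h21)

lemma DD_bound {m0 : MeasurableSpace ℝ} (μ : @Measure ℝ m0) (m1 m2 : MeasurableSpace ℝ)
    (f : ℝ → ℝ) (L : ℝ) (hf : ∀ x, |f x| ≤ L) : ∀ᵐ x ∂μ, |DD μ m1 m2 f x| ≤ 2 * L := by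
  have h1 := ae_bdd_abs_condExp_of_ae_bdd_abs (m := m1) (μ := μ) (ae_of_all μ hf)
  have h2 := ae_bdd_abs_condExp_of_ae_bdd_abs (m := m2) (μ := μ) (ae_of_all μ hf)
  filter_upwards [h1, h2] with x h1 h2
  unfold DD
  have := abs_sub ((μ[f | m1]) x) ((μ[f | m2]) x)
  linarith

lemma DD_int {m0 : MeasurableSpace ℝ} (μ : @Measure ℝ m0) (m1 m2 : MeasurableSpace ℝ)
    (f : ℝ → ℝ) : Integrable (DD μ m1 m2 f) μ := integrable_condExp.sub integrable_condExp

lemma DD_orth {m0 : MeasurableSpace ℝ} (μ : @Measure ℝ m0) [IsProbabilityMeasure μ]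
    (m1 m2 : MeasurableSpace ℝ) (h1 : m1 ≤ m0) (h21 : m2 ≤ m1)
    (ψ f : ℝ → ℝ) (hψ : StronglyMeasurable[m2] ψ) (c : ℝ) (hψc : ∀ᵐ x ∂μ, |ψ x| ≤ c) (hf : Integrable f μ) :
    ∫ x, ψ x * DD μ m1 m2 f x ∂μ = 0 := by
  have hψi : ∀ (m : MeasurableSpace ℝ), Integrable (fun x => ψ x * (μ[f|m]) x) μ := fun m =>
    integrable_condExp.bdd_mul (c := c) (hψ.mono (h21.trans h1)).aestronglyMeasurable hψc
  unfold DD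
  simp_rw [mul_sub]
  rw [integral_sub (hψi m1) (hψi m2), pull μ h1 ψ f (hψ.mono h21) c hψc hf,
    pull μ (h21.trans h1) ψ f hψ c hψc hf, sub_self]

lemma DD_sq {m0 : MeasurableSpace ℝ} (μ : @Measure ℝ m0) [IsProbabilityMeasure μ]
    (m1 m2 : MeasurableSpace ℝ) (h1 : m1 ≤ m0) (h21 : m2 ≤ m1)
    (f : ℝ → ℝ) (L : ℝ) (hf : Integrable f μ) (hfL : ∀ x, |f x| ≤ L) :
    ∫ x, (DD μ m1 m2 f x)^2 ∂μ = ∫ x, DD μ m1 m2 f x * f x ∂μ := by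
  have hb := DD_bound μ m1 m2 f L hfL
  have hi : ∀ (m : MeasurableSpace ℝ), Integrable (fun x => DD μ m1 m2 f x * (μ[f|m]) x) μ := fun m =>
    integrable_condExp.bdd_mul (c := 2 * L) ((DD_sm μ m1 m2 h21 f).mono h1).aestronglyMeasurable hb
  have e : ∀ x, (DD μ m1 m2 f x)^2 = DD μ m1 m2 f x * (μ[f|m1]) x - DD μ m1 m2 f x * (μ[f|m2]) x := by
    intro x
    rw [← mul_sub, sq]; rfl
  simp_rw [e]
  rw [integral_sub (hi m1) (hi m2), pull μ h1 _ f (DD_sm μ m1 m2 h21 f) _ hb hf]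
  have := DD_orth μ m1 m2 h1 h21 (μ[f|m2]) f stronglyMeasurable_condExp L
    (ae_bdd_abs_condExp_of_ae_bdd_abs (m := m2) (μ := μ) (ae_of_all μ hfL)) hf
  simp_rw [mul_comm (DD μ m1 m2 f _) ((μ[f|m2]) _)]
  rw [this, sub_zero]

/-- the decreasing filtration, trivial after time `n` -/
def Fil (T : ℝ → ℝ) (n k : ℕ) : MeasurableSpace ℝ :=
  if k ≤ n then MeasurableSpace.comap T^[k] Real.measurableSpace else ⊥

lemma Fil_le (T : ℝ → ℝ) (hT : Measurable T) (n k : ℕ) : Fil T n k ≤ Real.measurableSpace := by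
  unfold Fil
  split_ifs
  · exact (hT.iterate k).comap_le
  · exact bot_le

lemma Fil_anti (T : ℝ → ℝ) (hT : Measurable T) (n k : ℕ) : Fil T n (k+1) ≤ Fil T n k := by
  unfold Fil
  by_cases h : k + 1 ≤ n
  · rw [if_pos h, if_pos (by omega), Function.iterate_succ', ← MeasurableSpace.comap_comp]
    exact MeasurableSpace.comap_mono hT.comap_le
  · rw [if_neg h]; exact bot_le

lemma keyD (μ : Measure ℝ) [IsProbabilityMeasure μ] (T : ℝ → ℝ)
    (hT : MeasurePreserving T μ μ) (Cf : ℝ)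
    (hmain : ∀ (H : ℝ → ℝ → ℝ) (M ω : ℝ) (J ℓ : ℕ), Measurable (Function.uncurry H) → (∀ x y, |H x y| ≤ M) →
      (∀ x ∈ Icc (0:ℝ) 1, ∀ x' ∈ Icc (0:ℝ) 1, (∀ i < J, SameSide (T^[i] x) (T^[i] x')) → ∀ y, |H x y - H x' y| ≤ ω) →
      1 ≤ ℓ → |(∫ x, H x (T^[J + ℓ] x) ∂μ) - ∫ y, ∫ x, H x y ∂μ ∂μ| ≤ 2 * ω + Cf * M * (ℓ:ℝ)^(-(5/2):ℝ))
    (J ℓ k : ℕ) (hℓ : 1 ≤ ℓ) (hk : k = J + ℓ)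
    (n : ℕ) (hkn : k ≤ n)
    (G : ℝ → ℝ → ℝ) (hG : Measurable (Function.uncurry G)) (L ω : ℝ) (hGL : ∀ x y, |G x y| ≤ L)
    (hω : ∀ x ∈ Icc (0:ℝ) 1, ∀ x' ∈ Icc (0:ℝ) 1, (∀ i < J, SameSide (T^[i] x) (T^[i] x')) → ∀ y, |G x y - G x' y| ≤ ω)
    (hφ : StronglyMeasurable[Fil T n (k+1)] (fun x => ∫ x', G x' (T^[k+1] x) ∂μ)) :
    ∫ x, (DD μ (Fil T n k) (Fil T n (k+1)) (fun x => G x (T^[k+1] x)) x)^2 ∂μ ≤ 4 * L * ω + Cf * (2 * L^2) * (ℓ:ℝ)^(-(5/2):ℝ) := by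
  have hTm := hT.measurable
  have hL0 : 0 ≤ L := (abs_nonneg _).trans (hGL 0 0)
  have h1 := Fil_le T hTm n k
  have h21 := Fil_anti T hTm n k
  have hm1 : Fil T n k = MeasurableSpace.comap T^[k] Real.measurableSpace := by
    unfold Fil; rw [if_pos hkn]
  set g : ℝ → ℝ := fun x => G x (T^[k+1] x) with hg
  have hgm : Measurable g := hG.comp (measurable_id.prodMk (hTm.iterate (k+1)))
  have hgL : ∀ x, |g x| ≤ L := fun x => hGL _ _
  have hgi : Integrable g μ := Integrable.of_bound hgm.aestronglyMeasurable L (ae_of_all _ hgL)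
  rw [DD_sq μ (Fil T n k) (Fil T n (k+1)) h1 h21 g L hgi hgL]
  have hDb := DD_bound μ (Fil T n k) (Fil T n (k+1)) g L hgL
  obtain ⟨D0, hD0m, hD0⟩ : ∃ D0 : ℝ → ℝ, Measurable D0 ∧ DD μ (Fil T n k) (Fil T n (k+1)) g = D0 ∘ T^[k] := by
    have := DD_sm μ (Fil T n k) (Fil T n (k+1)) h21 g
    have h3 : StronglyMeasurable[MeasurableSpace.comap T^[k] Real.measurableSpace]
        (DD μ (Fil T n k) (Fil T n (k+1)) g) := hm1 ▸ this
    exact h3.measurable.exists_eq_measurable_comp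
  set D1 : ℝ → ℝ := fun y => max (-(2*L)) (min (D0 y) (2*L)) with hD1
  have hD1m : Measurable D1 := measurable_const.max (hD0m.min measurable_const)
  have hD1L : ∀ y, |D1 y| ≤ 2 * L := by
    intro y
    rw [abs_le]
    exact ⟨le_max_left _ _, max_le (by linarith) (min_le_right _ _)⟩
  have hD1e : ∀ᵐ x ∂μ, DD μ (Fil T n k) (Fil T n (k+1)) g x = D1 (T^[k] x) := by
    filter_upwards [hDb] with x hx
    rw [hD0] at hx ⊢
    simp only [Function.comp_apply] at hx ⊢
    have := abs_le.1 hx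
    simp only [hD1]
    rw [min_eq_left this.2, max_eq_right this.1]
  set H : ℝ → ℝ → ℝ := fun x y => D1 y * G x (T y) with hH
  have hHm : Measurable (Function.uncurry H) :=
    (hD1m.comp measurable_snd).mul (hG.comp (measurable_fst.prodMk (hTm.comp measurable_snd)))
  have hHM : ∀ x y, |H x y| ≤ 2 * L^2 := by
    intro x y
    simp only [hH]
    rw [abs_mul]
    calc _ ≤ (2 * L) * L := mul_le_mul (hD1L _) (hGL _ _) (abs_nonneg _) (by linarith)
      _ = _ := by ring
  have hHω : ∀ x ∈ Icc (0:ℝ) 1, ∀ x' ∈ Icc (0:ℝ) 1, (∀ i < J, SameSide (T^[i] x) (T^[i] x')) →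
      ∀ y, |H x y - H x' y| ≤ 2 * L * ω := by
    intro x hx x' hx' hs y
    simp only [hH]
    rw [← mul_sub, abs_mul]
    exact mul_le_mul (hD1L _) (hω x hx x' hx' hs _) (abs_nonneg _) (by linarith)
  have hm := hmain H (2 * L^2) (2 * L * ω) J ℓ hHm hHM hHω hℓ
  rw [← hk] at hm
  have e1 : ∫ x, DD μ (Fil T n k) (Fil T n (k+1)) g x * g x ∂μ = ∫ x, H x (T^[k] x) ∂μ := by
    refine integral_congr_ae ?_
    filter_upwards [hD1e] with x hx
    rw [hx]
    simp only [hH, hg, Function.iterate_succ_apply']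
  set φ : ℝ → ℝ := fun w => ∫ x', G x' w ∂μ with hφd
  have hφm : Measurable φ := (hG.stronglyMeasurable.integral_prod_left').measurable
  have hφb : ∀ w, |φ w| ≤ L := fun w => by
    simpa using norm_integral_le_of_norm_le_const (μ := μ) (f := fun u => G u w) (ae_of_all _ fun u => hGL u w)
  have e2 : ∫ y, ∫ x, H x y ∂μ ∂μ = 0 := by
    have s1 : ∀ y, ∫ x, H x y ∂μ = D1 y * φ (T y) := fun y => by
      simp only [hH]; rw [integral_const_mul]
    simp_rw [s1]
    have hTk := hT.iterate k
    have := integral_map (μ := μ) hTk.measurable.aemeasurable (f := fun y => D1 y * φ (T y))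
      (hD1m.mul (hφm.comp hTm)).aestronglyMeasurable
    rw [hTk.map_eq] at this
    rw [this, ← DD_orth μ (Fil T n k) (Fil T n (k+1)) h1 h21 _ g hφ L (ae_of_all _ fun x => hφb _) hgi]
    refine integral_congr_ae ?_
    filter_upwards [hD1e] with x hx
    rw [hx]
    simp only [Function.iterate_succ_apply']
    ring
  rw [e2, sub_zero] at hm
  rw [e1]
  have := (abs_le.1 hm).2
  linarith

lemma keyD_triv (μ : Measure ℝ) [IsProbabilityMeasure μ] 
    (T : ℝ → ℝ) (n k : ℕ)
    (g : ℝ → ℝ) (L : ℝ) (hgL : ∀ x, |g x| ≤ L) :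
    ∫ x, (DD μ (Fil T n k) (Fil T n (k+1)) g x)^2 ∂μ ≤ 4 * L^2 := by
  have hDb := DD_bound μ (Fil T n k) (Fil T n (k+1)) g L hgL
  have := norm_integral_le_of_norm_le_const (μ := μ) (f := fun x => (DD μ (Fil T n k) (Fil T n (k+1)) g x)^2) (C := 4 * L^2)
    (hDb.mono fun x hx => by
      rw [Real.norm_eq_abs, abs_pow]
      calc _ ≤ (2 * L)^2 := by gcongr
        _ = _ := by ring)
  have h2 := le_abs_self (∫ x, (DD μ (Fil T n k) (Fil T n (k+1)) g x)^2 ∂μ)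
  simp only [probReal_univ, mul_one, Real.norm_eq_abs] at this
  linarith

/-- Pythagoras -/
lemma pyth (μ : Measure ℝ) [IsProbabilityMeasure μ] (T : ℝ → ℝ) (hT : Measurable T) (N : ℕ)
    (Z : ℝ → ℝ) (B : ℝ) (hZ : ∀ x, |Z x| ≤ B) (hZi : Integrable Z μ) (c : ℝ) (n : ℕ) :
    ∫ x, ((μ[Z|Fil T N 0]) x - c)^2 ∂μ = ∑ k ∈ Finset.range n, ∫ x, (DD μ (Fil T N k) (Fil T N (k+1)) Z x)^2 ∂μ
      + ∫ x, ((μ[Z|Fil T N n]) x - c)^2 ∂μ := by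
  induction n with
  | zero => simp
  | succ n ih =>
    rw [ih, Finset.sum_range_succ, add_assoc]
    congr 1
    have hb : ∀ k, ∀ᵐ x ∂μ, |(μ[Z|Fil T N k]) x| ≤ B := fun k =>
      ae_bdd_abs_condExp_of_ae_bdd_abs (m := Fil T N k) (μ := μ) (ae_of_all μ hZ)
    set ψ : ℝ → ℝ := fun x => (μ[Z|Fil T N (n+1)]) x - c with hψ
    have hψm : StronglyMeasurable[Fil T N (n+1)] ψ := stronglyMeasurable_condExp.sub stronglyMeasurable_const
    have hψb : ∀ᵐ x ∂μ, |ψ x| ≤ B + |c| := (hb (n+1)).mono fun x hx => by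
      have := abs_sub ((μ[Z|Fil T N (n+1)]) x) c
      simp only [hψ]; linarith
    have ho := DD_orth μ (Fil T N n) (Fil T N (n+1)) (Fil_le T hT N n) (Fil_anti T hT N n) ψ Z hψm _ hψb hZi
    have hDb := DD_bound μ (Fil T N n) (Fil T N (n+1)) Z B hZ
    have hDm := ((DD_sm μ (Fil T N n) (Fil T N (n+1)) (Fil_anti T hT N n) Z).mono (Fil_le T hT N n)).aestronglyMeasurable (μ := μ)
    have hψm' := (hψm.mono (Fil_le T hT N (n+1))).aestronglyMeasurable (μ := μ)
    have i1 : Integrable (fun x => (DD μ (Fil T N n) (Fil T N (n+1)) Z x)^2) μ := by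
      have := (DD_int μ (Fil T N n) (Fil T N (n+1)) Z).bdd_mul hDm hDb
      simpa only [sq] using this
    have hψi : Integrable ψ μ := integrable_condExp.sub (integrable_const _)
    have i2 : Integrable (fun x => (ψ x)^2) μ := by
      have := hψi.bdd_mul hψm' hψb
      simpa only [sq] using this
    have i3 : Integrable (fun x => ψ x * DD μ (Fil T N n) (Fil T N (n+1)) Z x) μ :=
      (DD_int μ (Fil T N n) (Fil T N (n+1)) Z).bdd_mul hψm' hψb
    have e : ∀ x, ((μ[Z|Fil T N n]) x - c)^2 = (DD μ (Fil T N n) (Fil T N (n+1)) Z x)^2 + (ψ x)^2 + 2 * (ψ x * DD μ (Fil T N n) (Fil T N (n+1)) Z x) := by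
      intro x
      simp only [hψ, DD]; ring
    simp_rw [e]
    rw [integral_add (f := fun x => (DD μ (Fil T N n) (Fil T N (n+1)) Z x)^2 + (ψ x)^2) (i1.add i2) (i3.const_mul 2), integral_add i1 i2, integral_const_mul, ho, mul_zero, add_zero]

end VarIneq

open MeasureTheory Set

namespace VarIneq

noncomputable def aa (ℓ : ℕ) : ℝ := ((ℓ:ℝ)+1)^(-(5/4):ℝ)

lemma aa_pos (ℓ : ℕ) : 0 < aa ℓ := by unfold aa; positivity

lemma aa_sum : ∃ S : ℝ, 0 < S ∧ ∀ N : ℕ, ∑ ℓ ∈ Finset.range N, aa ℓ ≤ S := by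
  have h : Summable aa := by
    have h1 : Summable (fun n : ℕ => (n:ℝ)^(-(5/4):ℝ)) := Real.summable_nat_rpow.2 (by norm_num)
    have h2 := (summable_nat_add_iff 1).2 h1
    refine h2.congr fun n => ?_
    simp [aa]
  refine ⟨∑' ℓ, aa ℓ, ?_, fun N => h.sum_le_tsum _ fun ℓ _ => (aa_pos ℓ).le⟩
  exact h.tsum_pos (fun ℓ => (aa_pos ℓ).le) 0 (aa_pos 0)

lemma aa_refl (S : ℝ) (hS : ∀ N : ℕ, ∑ ℓ ∈ Finset.range N, aa ℓ ≤ S) (k : ℕ) :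
    ∑ j ∈ Finset.range (k+1), aa (k - j) ≤ S := by
  refine le_trans (le_of_eq ?_) (hS (k+1))
  have := Finset.sum_range_reflect aa (k+1)
  rw [← this]
  exact Finset.sum_congr rfl fun j _ => by congr 1

lemma conv_bound (S : ℝ) (hS : ∀ N : ℕ, ∑ ℓ ∈ Finset.range N, aa ℓ ≤ S) (x : ℕ → ℝ) (hx : ∀ j, 0 ≤ x j) (N : ℕ) :
    ∑ k ∈ Finset.range N, ∑ j ∈ Finset.range (k+1), aa (k - j) * x j ≤ S * ∑ j ∈ Finset.range N, x j := by
  have h1 : ∑ k ∈ Finset.range N, ∑ j ∈ Finset.range (k+1), aa (k - j) * x j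
      = ∑ j ∈ Finset.range N, ∑ k ∈ Finset.Ico j N, aa (k - j) * x j := by
    apply Finset.sum_comm'
    intro k j
    simp only [Finset.mem_range, Finset.mem_Ico]
    omega
  rw [h1, Finset.mul_sum]
  refine Finset.sum_le_sum fun j _ => ?_
  rw [← Finset.sum_mul]
  refine mul_le_mul_of_nonneg_right ?_ (hx j)
  rw [Finset.sum_Ico_eq_sum_range]
  refine le_trans (le_of_eq ?_) (hS (N - j))
  exact Finset.sum_congr rfl fun i _ => by congr 1; omega

lemma sum_bound (C : ℝ) (hC : 0 ≤ C) (S : ℝ) (hS0 : 0 < S) (hS : ∀ N : ℕ, ∑ ℓ ∈ Finset.range N, aa ℓ ≤ S)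
    (L : ℕ → ℝ) (hL : ∀ j, 0 ≤ L j) (N : ℕ → ℕ → ℝ) (m : ℕ)
    (hN : ∀ k < m, ∀ j ≤ k, N k j ≤ C * (L j ^ 2 * (((k - j : ℕ):ℝ)+1)^(-(5/2):ℝ)
      + ∑ i ∈ Finset.range (j+1), L j * L i * (((k - i : ℕ):ℝ)+1)^(-7:ℝ))) :
    ∑ k ∈ Finset.range m, ∑ j ∈ Finset.range (k+1), N k j / aa (k - j) ≤
      C * S * (1 + S) * ∑ j ∈ Finset.range m, L j ^ 2 := by
  set y : ℕ → ℝ := fun j => ∑ i ∈ Finset.range (j+1), (L i ^ 2 + L j ^ 2)/2 * aa (j - i) with hy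
  have hy0 : ∀ j, 0 ≤ y j := fun j => Finset.sum_nonneg fun i _ => by
    have := aa_pos (j - i)
    positivity
  have h1 : ∀ k < m, ∀ j ≤ k, N k j / aa (k - j) ≤ C * (aa (k - j) * (L j ^ 2 + y j)) := by
    intro k hk j hj
    have hap := aa_pos (k - j)
    rw [div_le_iff₀ hap]
    refine (hN k hk j hj).trans ?_
    rw [mul_assoc]
    apply mul_le_mul_of_nonneg_left _ hC
    have ha2 : aa (k-j) * aa (k-j) = (((k - j : ℕ):ℝ)+1)^(-(5/2):ℝ) := by
      unfold aa
      rw [← Real.rpow_add (by positivity)]; norm_num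
    have : aa (k - j) * (L j ^ 2 + y j) * aa (k - j) = L j ^ 2 * (aa (k-j) * aa (k-j)) + (aa (k-j) * aa (k-j)) * y j := by ring
    rw [this, ha2]
    apply add_le_add_right
    simp only [hy]
    rw [Finset.mul_sum]
    refine Finset.sum_le_sum fun i hi => ?_
    have hij : i ≤ j := by simpa [Nat.lt_succ_iff] using hi
    have hX : (((k - i : ℕ):ℝ)+1)^(-7:ℝ) ≤ (((k - j : ℕ):ℝ)+1)^(-(5/2):ℝ) * aa (j - i) := by
      set X : ℝ := ((k - i : ℕ):ℝ)+1 with hXd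
      have hX1 : 1 ≤ X := by simp [hXd]
      have e1 : X^(-7:ℝ) ≤ X^(-(5/2):ℝ) * X^(-(5/4):ℝ) := by
        rw [← Real.rpow_add (by linarith)]
        exact Real.rpow_le_rpow_of_exponent_le hX1 (by norm_num)
      refine e1.trans ?_
      unfold aa
      have g1 : (((k - j : ℕ):ℝ)+1) ≤ X := by
        rw [hXd]
        have : ((k - j : ℕ):ℝ) ≤ ((k - i : ℕ):ℝ) := by exact_mod_cast (by omega : k - j ≤ k - i)
        linarith
      have g2 : (((j - i : ℕ):ℝ)+1) ≤ X := by
        rw [hXd]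
        have : ((j - i : ℕ):ℝ) ≤ ((k - i : ℕ):ℝ) := by exact_mod_cast (by omega : j - i ≤ k - i)
        linarith
      refine mul_le_mul ?_ ?_ (by positivity) (by positivity)
      · exact Real.rpow_le_rpow_of_nonpos (by positivity) g1 (by norm_num)
      · exact Real.rpow_le_rpow_of_nonpos (by positivity) g2 (by norm_num)
    have hLL : L j * L i ≤ (L i ^ 2 + L j ^ 2)/2 := by nlinarith [sq_nonneg (L i - L j)]
    calc L j * L i * (((k - i : ℕ):ℝ)+1)^(-7:ℝ) ≤ (L i ^ 2 + L j ^ 2)/2 * ((((k - j : ℕ):ℝ)+1)^(-(5/2):ℝ) * aa (j - i)) :=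
          mul_le_mul hLL hX (by positivity) (by positivity)
      _ = _ := by ring
  have h2 : ∑ j ∈ Finset.range m, y j ≤ S * ∑ j ∈ Finset.range m, L j ^ 2 := by
    have e : ∀ j, y j ≤ 1/2 * (∑ i ∈ Finset.range (j+1), aa (j - i) * L i ^ 2) + 1/2 * (S * L j ^ 2) := by
      intro j
      have : y j = 1/2 * (∑ i ∈ Finset.range (j+1), aa (j - i) * L i ^ 2) + 1/2 * ((∑ i ∈ Finset.range (j+1), aa (j - i)) * L j ^ 2) := by
        simp only [hy]
        rw [Finset.sum_mul, Finset.mul_sum, Finset.mul_sum, ← Finset.sum_add_distrib]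
        exact Finset.sum_congr rfl fun i _ => by ring
      rw [this]
      have := aa_refl S hS j
      gcongr
    refine (Finset.sum_le_sum fun j _ => e j).trans ?_
    rw [Finset.sum_add_distrib, ← Finset.mul_sum, ← Finset.mul_sum, ← Finset.mul_sum]
    have := conv_bound S hS (fun i => L i ^ 2) (fun i => sq_nonneg _) m
    linarith
  calc _ ≤ ∑ k ∈ Finset.range m, ∑ j ∈ Finset.range (k+1), C * (aa (k - j) * (L j ^ 2 + y j)) := by
        refine Finset.sum_le_sum fun k hk => Finset.sum_le_sum fun j hj => ?_
        exact h1 k (Finset.mem_range.1 hk) j (by simpa [Nat.lt_succ_iff] using hj)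
    _ = C * ∑ k ∈ Finset.range m, ∑ j ∈ Finset.range (k+1), aa (k - j) * (L j ^ 2 + y j) := by
        simp_rw [← Finset.mul_sum]
    _ ≤ C * (S * ∑ j ∈ Finset.range m, (L j ^ 2 + y j)) := by
        apply mul_le_mul_of_nonneg_left _ hC
        exact conv_bound S hS _ (fun j => add_nonneg (sq_nonneg _) (hy0 j)) m
    _ ≤ C * (S * ((1 + S) * ∑ j ∈ Finset.range m, L j ^ 2)) := by
        rw [Finset.sum_add_distrib]
        gcongr
        linarith
    _ = _ := by ring

lemma cs_bound (S : ℝ) (hS : ∀ N : ℕ, ∑ ℓ ∈ Finset.range N, aa ℓ ≤ S) (k : ℕ) (d : ℕ → ℝ) :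
    (∑ j ∈ Finset.range (k+1), d j)^2 ≤ S * ∑ j ∈ Finset.range (k+1), d j ^ 2 / aa (k - j) := by
  have h1 := Finset.sum_sq_le_sum_mul_sum_of_sq_eq_mul (Finset.range (k+1)) (r := d)
    (f := fun j => aa (k - j)) (g := fun j => d j ^ 2 / aa (k - j)) (fun j _ => (aa_pos _).le)
    (fun j _ => div_nonneg (sq_nonneg _) (aa_pos _).le) (fun j _ => by
      have := (aa_pos (k - j)).ne'
      field_simp)
  refine h1.trans ?_
  refine mul_le_mul_of_nonneg_right (aa_refl S hS k) (Finset.sum_nonneg fun j _ => div_nonneg (sq_nonneg _) (aa_pos _).le)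

end VarIneq

open MeasureTheory Set

namespace VarIneq

lemma telescope (Q : (ℕ → ℝ) → ℝ) (L : ℕ → ℝ)
    (h1 : ∀ j (z zz : ℕ → ℝ), (∀ i, i ≠ j → z i = zz i) → |Q z - Q zz| ≤ L j * |z j - zz j|) (m : ℕ) :
    ∀ z zz : ℕ → ℝ, (∀ i, m ≤ i → z i = zz i) →
      |Q z - Q zz| ≤ ∑ i ∈ Finset.range m, L i * |z i - zz i| := by
  induction m with
  | zero =>
    intro z zz h
    have : z = zz := funext fun i => h i (Nat.zero_le _)
    simp [this]
  | succ m ih =>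
    intro z zz h
    set z1 : ℕ → ℝ := fun i => if i = m then zz m else z i with hz1
    have e1 : |Q z - Q z1| ≤ L m * |z m - zz m| := by
      have := h1 m z z1 (fun i hi => by simp [hz1, hi])
      simpa [hz1] using this
    have e2 := ih z1 zz (fun i hi => by
      simp only [hz1]
      split_ifs with h'
      · rw [h']
      · exact h i (by omega))
    have e3 : ∑ i ∈ Finset.range m, L i * |z1 i - zz i| = ∑ i ∈ Finset.range m, L i * |z i - zz i| := by
      refine Finset.sum_congr rfl fun i hi => ?_
      have : i ≠ m := (Finset.mem_range.1 hi).ne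
      simp [hz1, this]
    rw [e3] at e2
    rw [Finset.sum_range_succ]
    have := abs_sub_le (Q z) (Q z1) (Q zz)
    linarith

/-- interpolating sequences -/
def sq (T : ℝ → ℝ) (m k : ℕ) (x w : ℝ) (i : ℕ) : ℝ :=
  if i < m then T^[i] x else if i ≤ k then 0 else T^[i - (k+1)] w

lemma sq_measurable (T : ℝ → ℝ) (hT : Measurable T) (m k : ℕ) :
    Measurable (fun p : ℝ × ℝ => sq T m k p.1 p.2) := by
  rw [measurable_pi_iff]
  intro i
  unfold sq
  split_ifs
  · exact (hT.iterate i).comp measurable_fst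
  · exact measurable_const
  · exact (hT.iterate _).comp measurable_snd

def GG (T : ℝ → ℝ) (Q : (ℕ → ℝ) → ℝ) (j k : ℕ) (x w : ℝ) : ℝ :=
  Q (sq T (j+1) k x w) - Q (sq T j k x w)

lemma DD_sum {m0 : MeasurableSpace ℝ} (μ : @Measure ℝ m0) [IsProbabilityMeasure μ]
    (m1 m2 : MeasurableSpace ℝ) (h1 : m1 ≤ m0) (h21 : m2 ≤ m1) (s : Finset ℕ)
    (g : ℕ → ℝ → ℝ) (r Z : ℝ → ℝ) (hg : ∀ j ∈ s, Integrable (g j) μ) (hr : StronglyMeasurable[m2] r)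
    (hri : Integrable r μ) (hZ : Z = (∑ j ∈ s, g j) + r) :
    ∀ᵐ x ∂μ, DD μ m1 m2 Z x = ∑ j ∈ s, DD μ m1 m2 (g j) x := by
  have hsi : Integrable (∑ j ∈ s, g j) μ := integrable_finsetSum' _ hg
  have a1 := condExp_add hsi hri m1
  have a2 := condExp_add hsi hri m2
  have b1 := condExp_finsetSum hg m1
  have b2 := condExp_finsetSum hg m2
  have c1 := condExp_of_stronglyMeasurable h1 (hr.mono h21) hri
  have c2 := condExp_of_stronglyMeasurable (h21.trans h1) hr hri
  filter_upwards [a1, a2, b1, b2] with x a1 a2 b1 b2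
  unfold DD
  rw [hZ, a1, a2, Pi.add_apply, Pi.add_apply, b1, b2, c1, c2, Finset.sum_apply, Finset.sum_apply,
    Finset.sum_sub_distrib]
  ring

lemma half_bound (i j k : ℕ) (hij : i ≤ j) (hjk : j < k) :
    (((k - i : ℕ) : ℝ) + 1) / 2 ≤ ((j + (k - j) / 2 - i : ℕ) : ℝ) + 1 := by
  have h : k - i + 1 ≤ 2 * (j + (k - j) / 2 - i + 1) := by omega
  have h' : ((k - i : ℕ) : ℝ) + 1 ≤ 2 * (((j + (k - j) / 2 - i : ℕ) : ℝ) + 1) := by exact_mod_cast h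
  linarith

lemma quarter_bound (j k : ℕ) (hjk : j < k) :
    (((k - j : ℕ) : ℝ) + 1) / 4 ≤ ((k - j - (k - j) / 2 : ℕ) : ℝ) := by
  have h : k - j + 1 ≤ 4 * (k - j - (k - j) / 2) := by omega
  have h' : ((k - j : ℕ) : ℝ) + 1 ≤ 4 * (((k - j - (k - j) / 2 : ℕ) : ℝ)) := by exact_mod_cast h
  linarith

lemma variance_seq (μ : Measure ℝ) [IsProbabilityMeasure μ] (T : ℝ → ℝ)
    (hT : MeasurePreserving T μ μ) (Cf : ℝ) (hCf : 0 ≤ Cf)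
    (hmain : ∀ (H : ℝ → ℝ → ℝ) (M ω : ℝ) (J ℓ : ℕ), Measurable (Function.uncurry H) → (∀ x y, |H x y| ≤ M) →
      (∀ x ∈ Icc (0:ℝ) 1, ∀ x' ∈ Icc (0:ℝ) 1, (∀ i < J, SameSide (T^[i] x) (T^[i] x')) → ∀ y, |H x y - H x' y| ≤ ω) →
      1 ≤ ℓ → |(∫ x, H x (T^[J + ℓ] x) ∂μ) - ∫ y, ∫ x, H x y ∂μ ∂μ| ≤ 2 * ω + Cf * M * (ℓ:ℝ)^(-(5/2):ℝ))
    (B : ℝ) (hB : 0 ≤ B)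
    (hcon : ∀ J i : ℕ, i ≤ J → ∀ x ∈ Icc (0:ℝ) 1, ∀ x' ∈ Icc (0:ℝ) 1, (∀ i < J, SameSide (T^[i] x) (T^[i] x')) →
      |T^[i] x - T^[i] x'| ≤ B / (((J - i : ℕ) : ℝ) + 1)^7)
    (S : ℝ) (hS0 : 0 < S) (hS : ∀ N : ℕ, ∑ ℓ ∈ Finset.range N, aa ℓ ≤ S)
    (n : ℕ) (Q : (ℕ → ℝ) → ℝ) (L : ℕ → ℝ) (hL : ∀ j, 0 ≤ L j) (hQm : Measurable Q)
    (h1 : ∀ j (z zz : ℕ → ℝ), (∀ i, i ≠ j → z i = zz i) → |Q z - Q zz| ≤ L j * |z j - zz j|)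
    (h2 : ∀ j (z zz : ℕ → ℝ), (∀ i, i ≠ j → z i = zz i) → |Q z - Q zz| ≤ L j)
    (h3 : ∀ z zz : ℕ → ℝ, (∀ i < n, z i = zz i) → Q z = Q zz)
    (Bd : ℝ) (h4 : ∀ z, |Q z| ≤ Bd) :
    ∫ x, (Q (fun i => T^[i] x) - ∫ y, Q (fun i => T^[i] y) ∂μ)^2 ∂μ ≤
      S * ((1024 * B + 64 * Cf + 4) * S * (1 + S) * ∑ j ∈ Finset.range (n+1), L j ^ 2) := by
  have hTm := hT.measurable
  set Z : ℝ → ℝ := fun x => Q (fun i => T^[i] x) with hZ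
  have hZm : Measurable Z := hQm.comp (measurable_pi_iff.2 fun i => hTm.iterate i)
  have hZb : ∀ x, |Z x| ≤ Bd := fun x => h4 _
  have hZi : Integrable Z μ := Integrable.of_bound hZm.aestronglyMeasurable Bd (ae_of_all _ hZb)
  set C : ℝ := 1024 * B + 64 * Cf + 4 with hC
  have hC0 : 0 ≤ C := by positivity
  have hQs : ∀ m k, Measurable (fun p : ℝ × ℝ => Q (sq T m k p.1 p.2)) := fun m k =>
    hQm.comp (sq_measurable T hTm m k)
  have hGm : ∀ j k, Measurable (Function.uncurry (GG T Q j k)) := fun j k => (hQs _ _).sub (hQs _ _)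
  have hGL : ∀ j k x w, |GG T Q j k x w| ≤ L j := by
    intro j k x w
    refine h2 j _ _ fun i hi => ?_
    unfold sq
    have : i < j + 1 ↔ i < j := by omega
    simp only [this]
  set g : ℕ → ℕ → ℝ → ℝ := fun k j x => GG T Q j k x (T^[k+1] x) with hg
  have hgm : ∀ k j, Measurable (g k j) := fun k j => (hGm j k).comp (measurable_id.prodMk (hTm.iterate (k+1)))
  have hgi : ∀ k j, Integrable (g k j) μ := fun k j =>
    Integrable.of_bound (hgm k j).aestronglyMeasurable (L j) (ae_of_all _ fun x => hGL _ _ _ _)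
  set N : ℕ → ℕ → ℝ := fun k j => ∫ x, (DD μ (Fil T n k) (Fil T n (k+1)) (g k j) x)^2 ∂μ with hN
  -- independence of the last variable at time n
  have hGn : ∀ m x w w', Q (sq T m n x w) = Q (sq T m n x w') := by
    intro m x w w'
    refine h3 _ _ fun i hi => ?_
    unfold sq
    rw [if_pos hi.le, if_pos hi.le]
  have hmeas : ∀ k ≤ n, ∀ φ : ℝ → ℝ, Measurable φ → (k = n → ∀ w w', φ w = φ w') →
      StronglyMeasurable[Fil T n (k+1)] (fun x => φ (T^[k+1] x)) := by
    intro k hk φ hφ hconst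
    rcases hk.eq_or_lt with h | h
    · have : (fun x => φ (T^[k+1] x)) = fun _ => φ 0 := funext fun x => hconst h _ _
      rw [this]; exact stronglyMeasurable_const
    · have e : Fil T n (k+1) = MeasurableSpace.comap T^[k+1] Real.measurableSpace := by
        unfold Fil; rw [if_pos (by omega)]
      rw [e]
      exact (hφ.comp (comap_measurable _)).stronglyMeasurable
  -- bounds on N
  have hNb : ∀ k < n + 1, ∀ j ≤ k, N k j ≤ C * (L j ^ 2 * (((k - j : ℕ):ℝ)+1)^(-(5/2):ℝ)
      + ∑ i ∈ Finset.range (j+1), L j * L i * (((k - i : ℕ):ℝ)+1)^(-7:ℝ)) := by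
    intro k hk j hj
    have hsum0 : 0 ≤ ∑ i ∈ Finset.range (j+1), L j * L i * (((k - i : ℕ):ℝ)+1)^(-7:ℝ) :=
      Finset.sum_nonneg fun i _ => by
        have := hL i
        have := hL j
        positivity
    rcases hj.eq_or_lt with h | h
    · have hb : N k j ≤ 4 * L j ^ 2 := keyD_triv μ T n k (g k j) (L j) (fun x => hGL _ _ _ _)
      refine hb.trans ?_
      subst h
      rw [Nat.sub_self]
      norm_num
      have : 0 ≤ (C - 4) * L j ^ 2 := mul_nonneg (by rw [hC]; linarith [hB, hCf]) (sq_nonneg _)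
      have := mul_nonneg hC0 hsum0
      norm_num at this
      nlinarith
    · set J := j + (k - j) / 2 with hJ
      set ℓ := k - j - (k - j) / 2 with hℓ
      have hω : ∀ x ∈ Icc (0:ℝ) 1, ∀ x' ∈ Icc (0:ℝ) 1, (∀ i < J, SameSide (T^[i] x) (T^[i] x')) →
          ∀ y, |GG T Q j k x y - GG T Q j k x' y| ≤
            2 * ∑ i ∈ Finset.range (j+1), L i * (128 * B * (((k - i : ℕ):ℝ)+1)^(-7:ℝ)) := by
        intro x hx x' hx' hs y
        have hT1 : ∀ m ≤ j + 1, |Q (sq T m k x y) - Q (sq T m k x' y)| ≤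
            ∑ i ∈ Finset.range (j+1), L i * (128 * B * (((k - i : ℕ):ℝ)+1)^(-7:ℝ)) := by
          intro m hm
          refine (telescope Q L h1 (j+1) (sq T m k x y) (sq T m k x' y) (fun i hi => ?_)).trans ?_
          · unfold sq
            simp only [if_neg (show ¬ i < m by omega)]
          · refine Finset.sum_le_sum fun i hi => ?_
            have hij : i ≤ j := by simpa [Nat.lt_succ_iff] using hi
            apply mul_le_mul_of_nonneg_left _ (hL i)
            unfold sq
            split_ifs
            · refine (hcon J i (by omega) x hx x' hx' hs).trans ?_
              have hh := half_bound i j k hij h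
              rw [← hJ] at hh
              have hX0 : (0:ℝ) < ((k - i : ℕ) : ℝ) + 1 := by positivity
              rw [show (-7:ℝ) = -((7:ℕ):ℝ) by norm_num, Real.rpow_neg hX0.le, Real.rpow_natCast]
              calc B / (((J - i : ℕ) : ℝ) + 1)^7 ≤ B / ((((k - i : ℕ) : ℝ) + 1)/2)^7 := by gcongr
                _ = _ := by
                  field_simp
                  norm_num
            · simp; positivity
            · simp; positivity
        have t1 := abs_le.1 (hT1 (j+1) le_rfl)
        have t2 := abs_le.1 (hT1 j (by omega))
        unfold GG
        rw [abs_le]; constructor <;> linarith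
      have hφm : Measurable (fun w => ∫ x', GG T Q j k x' w ∂μ) :=
        ((hGm j k).stronglyMeasurable.integral_prod_left').measurable
      have hk' := keyD μ T hT Cf hmain J ℓ k (by omega) (by omega) n (by omega) (GG T Q j k) (hGm j k) (L j) _
        (hGL j k) hω (hmeas k (by omega) (fun w => ∫ x', GG T Q j k x' w ∂μ) hφm (fun hkn w w' => by
          subst hkn
          refine integral_congr_ae (ae_of_all _ fun x => ?_)
          simp only [GG]
          rw [hGn _ x w w', hGn _ x w w']))
      refine hk'.trans ?_
      have hl4 : (ℓ:ℝ)^(-(5/2):ℝ) ≤ 32 * (((k - j : ℕ):ℝ)+1)^(-(5/2):ℝ) := by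
        have hq := quarter_bound j k h
        rw [← hℓ] at hq
        have hX0 : (0:ℝ) < ((k - j : ℕ) : ℝ) + 1 := by positivity
        refine (Real.rpow_le_rpow_of_nonpos (by positivity) hq (by norm_num)).trans (le_of_eq ?_)
        rw [Real.div_rpow hX0.le (by norm_num)]
        have : (4:ℝ)^(-(5/2):ℝ) = 1/32 := by
          rw [show (4:ℝ) = 2^(2:ℝ) by norm_num, ← Real.rpow_mul (by norm_num)]
          norm_num
        rw [this]; ring
      have e1 : 4 * L j * (2 * ∑ i ∈ Finset.range (j+1), L i * (128 * B * (((k - i : ℕ):ℝ)+1)^(-7:ℝ))) =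
          1024 * B * ∑ i ∈ Finset.range (j+1), L j * L i * (((k - i : ℕ):ℝ)+1)^(-7:ℝ) := by
        rw [← mul_assoc, Finset.mul_sum, Finset.mul_sum]
        exact Finset.sum_congr rfl fun i _ => by ring
      rw [e1]
      have e2 : Cf * (2 * L j ^ 2) * (ℓ:ℝ)^(-(5/2):ℝ) ≤ 64 * Cf * (L j ^ 2 * (((k - j : ℕ):ℝ)+1)^(-(5/2):ℝ)) := by
        calc _ ≤ Cf * (2 * L j ^ 2) * (32 * (((k - j : ℕ):ℝ)+1)^(-(5/2):ℝ)) := by gcongr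
          _ = _ := by ring
      have p1 : 0 ≤ L j ^ 2 * (((k - j : ℕ):ℝ)+1)^(-(5/2):ℝ) := by positivity
      rw [mul_add]
      have q1 : 64 * Cf * (L j ^ 2 * (((k - j : ℕ):ℝ)+1)^(-(5/2):ℝ)) ≤ C * (L j ^ 2 * (((k - j : ℕ):ℝ)+1)^(-(5/2):ℝ)) :=
        mul_le_mul_of_nonneg_right (by rw [hC]; linarith) p1
      have q2 := mul_le_mul_of_nonneg_right (show 1024 * B ≤ C by rw [hC]; linarith) hsum0
      linarith
  -- martingale differences
  have hDk : ∀ k < n + 1, ∫ x, (DD μ (Fil T n k) (Fil T n (k+1)) Z x)^2 ∂μ ≤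
      S * ∑ j ∈ Finset.range (k+1), N k j / aa (k - j) := by
    intro k hk
    have hrm : Measurable (fun w => Q (sq T 0 k 0 w)) := (hQs 0 k).comp measurable_prodMk_left
    have hdec := DD_sum μ (Fil T n k) (Fil T n (k+1)) (Fil_le T hTm n k) (Fil_anti T hTm n k)
      (Finset.range (k+1)) (g k) (fun x => Q (sq T 0 k 0 (T^[k+1] x))) Z (fun j _ => hgi k j)
      (hmeas k (by omega) (fun w => Q (sq T 0 k 0 w)) hrm (fun hkn w w' => by subst hkn; exact hGn _ _ _ _))
      (Integrable.of_bound (hrm.comp (hTm.iterate (k+1))).aestronglyMeasurable Bd (ae_of_all _ fun x => h4 _))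
      (by
        funext x
        rw [Pi.add_apply, Finset.sum_apply]
        simp only [hg, GG]
        rw [Finset.sum_range_sub (fun j => Q (sq T j k x (T^[k+1] x)))]
        have e0 : sq T 0 k x (T^[k+1] x) = sq T 0 k 0 (T^[k+1] x) := by
          funext i; unfold sq; simp
        have e1 : sq T (k+1) k x (T^[k+1] x) = fun i => T^[i] x := by
          funext i
          unfold sq
          split_ifs with ha hb
          · rfl
          · omega
          · rw [← Function.iterate_add_apply]
            congr 2
            omega
        rw [e0, e1]
        simp [hZ])
    have hDi : ∀ j, Integrable (fun x => (DD μ (Fil T n k) (Fil T n (k+1)) (g k j) x)^2) μ := by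
      intro j
      have hDb := DD_bound μ (Fil T n k) (Fil T n (k+1)) (g k j) (L j) (fun x => hGL _ _ _ _)
      have := (DD_int μ (Fil T n k) (Fil T n (k+1)) (g k j)).bdd_mul
        (((DD_sm μ (Fil T n k) (Fil T n (k+1)) (Fil_anti T hTm n k) (g k j)).mono (Fil_le T hTm n k)).aestronglyMeasurable) hDb
      simpa only [_root_.sq] using this
    have hZi2 : Integrable (fun x => (DD μ (Fil T n k) (Fil T n (k+1)) Z x)^2) μ := by
      have hDb := DD_bound μ (Fil T n k) (Fil T n (k+1)) Z Bd hZb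
      have := (DD_int μ (Fil T n k) (Fil T n (k+1)) Z).bdd_mul
        (((DD_sm μ (Fil T n k) (Fil T n (k+1)) (Fil_anti T hTm n k) Z).mono (Fil_le T hTm n k)).aestronglyMeasurable) hDb
      simpa only [_root_.sq] using this
    calc _ ≤ ∫ x, S * ∑ j ∈ Finset.range (k+1), (DD μ (Fil T n k) (Fil T n (k+1)) (g k j) x)^2 / aa (k - j) ∂μ := by
          refine integral_mono_ae hZi2 ?_ ?_
          · exact (integrable_finsetSum _ fun j _ => (hDi j).div_const _).const_mul S
          · filter_upwards [hdec] with x hx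
            rw [hx]
            exact cs_bound S hS k _
      _ = _ := by
          rw [integral_const_mul, integral_finsetSum _ fun j _ => (hDi j).div_const _]
          simp only [integral_div, hN]
  have hp := pyth μ T hTm n Z Bd hZb hZi (∫ y, Z y ∂μ) (n+1)
  have hM0 : μ[Z | Fil T n 0] = Z := by
    have e : Fil T n 0 = Real.measurableSpace := by
      unfold Fil; simp
    exact condExp_of_stronglyMeasurable (Fil_le T hTm n 0) (e ▸ hZm.stronglyMeasurable) hZi
  have hMn : μ[Z | Fil T n (n+1)] = fun _ => ∫ y, Z y ∂μ := by
    have e : Fil T n (n+1) = ⊥ := by unfold Fil; simp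
    rw [e]; exact condExp_bot Z
  rw [hM0, hMn] at hp
  simp only [sub_self, ne_eq, OfNat.ofNat_ne_zero, not_false_eq_true, zero_pow, integral_zero, add_zero] at hp
  rw [hp]
  refine (Finset.sum_le_sum fun k hk => hDk k (Finset.mem_range.1 hk)).trans ?_
  rw [← Finset.mul_sum]
  exact mul_le_mul_of_nonneg_left (sum_bound C hC0 S hS0 hS L hL N (n+1) hNb) hS0.le

end VarIneq

open MeasureTheory Set
namespace VarIneq

noncomputable def clamp (t : ℝ) : ℝ := max 0 (min t 1)

lemma clamp_mem (t : ℝ) : clamp t ∈ Icc (0:ℝ) 1 :=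
  ⟨le_max_left _ _, max_le zero_le_one (min_le_right _ _)⟩

lemma clamp_of_mem (t : ℝ) (ht : t ∈ Icc (0:ℝ) 1) : clamp t = t := by
  unfold clamp; rw [min_eq_left ht.2, max_eq_right ht.1]

lemma clamp_lip (s t : ℝ) : |clamp s - clamp t| ≤ |s - t| := by
  unfold clamp
  have h1 := abs_max_sub_max_le_abs (min s 1) (min t 1) 0
  have h2 := abs_min_sub_min_le_max s 1 t 1
  rw [max_comm 0, max_comm 0]
  refine h1.trans (h2.trans ?_)
  simp

lemma clamp_diff (s t : ℝ) : |clamp s - clamp t| ≤ 1 := by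
  have h1 := clamp_mem s
  have h2 := clamp_mem t
  rw [abs_le]; constructor <;> linarith [h1.1, h1.2, h2.1, h2.2]

lemma clamp_cont : Continuous clamp := by unfold clamp; fun_prop

/-- extension of coefficients -/
noncomputable def LLx {n : ℕ} (L : Fin n → ℝ) (j : ℕ) : ℝ := if h : j < n then L ⟨j, h⟩ else 0

lemma K_lip {n : ℕ} (K : (Fin n → ℝ) → ℝ) (L : Fin n → ℝ)
    (hK : ∀ (j : Fin n) (z zz : Fin n → ℝ), (∀ i, i ≠ j → z i = zz i) →
        |K z - K zz| ≤ L j * |z j - zz j|) (j : ℕ) (z zz : ℕ → ℝ) (hz : ∀ i, i ≠ j → z i = zz i) :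
    |K (fun i => z i) - K (fun i => zz i)| ≤ LLx L j * |z j - zz j| := by
  unfold LLx
  split_ifs with h
  · exact hK ⟨j, h⟩ _ _ fun i hi => hz i fun e => hi (Fin.ext e)
  · have : (fun i : Fin n => z i) = fun i : Fin n => zz i :=
      funext fun i => hz i (by have := i.2; omega)
    rw [this]; simp

lemma LLx_nonneg {n : ℕ} (K : (Fin n → ℝ) → ℝ) (L : Fin n → ℝ)
    (hK : ∀ (j : Fin n) (z zz : Fin n → ℝ), (∀ i, i ≠ j → z i = zz i) →
        |K z - K zz| ≤ L j * |z j - zz j|) (j : ℕ) : 0 ≤ LLx L j := by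
  have h := K_lip K L hK j (Function.update (fun _ => 0) j 1) (fun _ => 0) (fun i hi => by simp [hi])
  have := (abs_nonneg _).trans h
  simpa using this

lemma K_cont {n : ℕ} (K : (Fin n → ℝ) → ℝ) (L : Fin n → ℝ)
    (hK : ∀ (j : Fin n) (z zz : Fin n → ℝ), (∀ i, i ≠ j → z i = zz i) →
        |K z - K zz| ≤ L j * |z j - zz j|) : Continuous K := by
  have hnn := LLx_nonneg K L hK
  have key : LipschitzWith (Real.toNNReal (∑ i ∈ Finset.range n, LLx L i)) K := by
    refine LipschitzWith.of_dist_le_mul fun a b => ?_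
    rw [Real.coe_toNNReal _ (Finset.sum_nonneg fun i _ => hnn i)]
    have h := telescope (fun z => K (fun i => z i)) (LLx L) (K_lip K L hK) n
      (fun i => if h : i < n then a ⟨i, h⟩ else 0) (fun i => if h : i < n then b ⟨i, h⟩ else 0)
      (fun i hi => by simp [show ¬ i < n by omega])
    simp only [Fin.is_lt, dite_true, Fin.eta] at h
    rw [Real.dist_eq]
    refine h.trans ?_
    rw [Finset.sum_mul]
    refine Finset.sum_le_sum fun i hi => mul_le_mul_of_nonneg_left ?_ (hnn i)
    have hi' := Finset.mem_range.1 hi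
    simp only [hi', dite_true]
    rw [← Real.dist_eq]
    exact dist_le_pi_dist a b _
  exact key.continuous

lemma LLx_sum {n : ℕ} (L : Fin n → ℝ) :
    ∑ j ∈ Finset.range (n+1), LLx L j ^ 2 = ∑ j, L j ^ 2 := by
  rw [Finset.sum_range_succ, Finset.sum_range]
  simp [LLx]

lemma final (α : ℝ) (hα0 : 0 < α) (hα1 : α < 4 - Real.sqrt 15)
    (T : ℝ → ℝ) (hT_maps : MapsTo T (Icc (0:ℝ) 1) (Icc (0:ℝ) 1))
    (hT_formula : ∀ x ∈ Ico (0:ℝ) (1/2), T x = x + (2:ℝ) ^ α * x ^ (1 + α))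
    (T' : ℝ → ℝ)
    (hT_deriv : ∀ x ∈ Icc (1/2:ℝ) 1, HasDerivWithinAt T (T' x) (Icc (1/2:ℝ) 1) x)
    (hT_C2 : ContDiffOn ℝ 2 T (Icc (1/2:ℝ) 1))
    (hT_bij : BijOn T (Icc (1/2:ℝ) 1) (Icc (0:ℝ) 1))
    (hT_expanding : ∀ x ∈ Icc (1/2:ℝ) 1, 1 < |T' x|)
    (h : ℝ → ℝ) (c₁ c₂ : ℝ) (hc₁ : 0 < c₁) (hc₁₂ : c₁ ≤ c₂)
    (hdens : ∀ x ∈ Ioc (0:ℝ) 1, c₁ * x ^ (-α) ≤ h x ∧ h x ≤ c₂ * x ^ (-α))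
    (μ : Measure ℝ) (hprob : IsProbabilityMeasure μ)
    (hμ : μ = (volume.restrict (Icc (0:ℝ) 1)).withDensity (fun x => ENNReal.ofReal (h x)))
    (hinv : MeasurePreserving T μ μ)
    (C₀ : ℝ) (hC₀ : 0 < C₀)
    (hdecay : ∀ (v w : ℝ → ℝ) (Mv : ℝ) (Lw : NNReal),
      ContinuousOn v (Icc (0:ℝ) 1) → (∀ x ∈ Icc (0:ℝ) 1, |v x| ≤ Mv) →
      LipschitzOnWith Lw w (Icc (0:ℝ) 1) →
      ∀ ℓ : ℕ, 1 ≤ ℓ →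
        |(∫ x, v (T^[ℓ] x) * w x ∂μ) - (∫ x, v x ∂μ) * (∫ x, w x ∂μ)|
          ≤ C₀ * Mv * (Lw : ℝ) * (ℓ : ℝ) ^ (1 - 1/α)) :
    ∃ D > (0:ℝ), ∀ n : ℕ, 1 ≤ n → ∀ (K : (Fin n → ℝ) → ℝ) (L : Fin n → ℝ),
      (∀ (j : Fin n) (z zz : Fin n → ℝ), (∀ i, i ≠ j → z i = zz i) →
        |K z - K zz| ≤ L j * |z j - zz j|) →
      ∫ x, (K (fun i => T^[(i:ℕ)] x) - ∫ y, K (fun i => T^[(i:ℕ)] y) ∂μ) ^ 2 ∂μ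
        ≤ D * ∑ j, (L j) ^ 2 := by
  have hα7 : 7 * α ≤ 1 := by
    have : (27/7:ℝ) < Real.sqrt 15 := by
      apply Real.lt_sqrt_of_sq_lt; norm_num
    linarith
  have hTm := hinv.measurable
  have hsupp := dens_ae h μ hμ
  have hsuppc : ∀ᵐ x ∂μ, x ∈ Icc (0:ℝ) 1 := hsupp.mono fun x hx => ⟨hx.1.le, hx.2⟩
  have hexp6 : 1 - 1/α ≤ -6 := by
    have : 7 ≤ 1/α := by rw [le_div_iff₀ hα0]; exact hα7
    linarith
  have hdecm := decay_meas μ T hinv hsuppc (fun ℓ => C₀ * (ℓ:ℝ)^(-6:ℝ)) (by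
    intro v w Mv Lw hv hvM hw ℓ hℓ
    refine (hdecay v w Mv Lw hv hvM hw ℓ hℓ).trans ?_
    have hM : 0 ≤ Mv := (abs_nonneg _).trans (hvM 0 ⟨le_rfl, zero_le_one⟩)
    have : (ℓ:ℝ)^(1 - 1/α) ≤ (ℓ:ℝ)^(-6:ℝ) :=
      Real.rpow_le_rpow_of_exponent_le (by exact_mod_cast hℓ) hexp6
    calc C₀ * Mv * (Lw : ℝ) * (ℓ : ℝ) ^ (1 - 1/α) ≤ C₀ * Mv * (Lw : ℝ) * (ℓ:ℝ)^(-6:ℝ) := by gcongr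
      _ = _ := by ring)
  obtain ⟨lam, C2, hlam, hC2, hr1, hr2⟩ := right_branch T T' hT_deriv hT_C2 hT_expanding
  have hl1 : 0 < lam - 1 := by linarith
  set A : ℝ := (4 + C2) / (lam - 1) with hAdef
  have hA : 0 ≤ A := by positivity
  have hA' : 4 + C2 ≤ A * (lam - 1) := by rw [hAdef, div_mul_cancel₀ _ hl1.ne']
  have hkey := right_dd lam C2 hlam T T' hr1 hr2 A hA hA'
  have hb : ∀ b ν, Reg A ν → Reg A ((ν.restrict (side b)).map T) := by
    intro b ν hν
    cases b
    · exact reg_right A T T' hTm hT_deriv hT_bij hT_expanding hkey ν hν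
    · exact reg_left A α hA hα0 (by linarith) T hTm hT_formula ν hν
  have hpm : IsProbabilityMeasure (volume.restrict (Ioc (0:ℝ) 1)) := ⟨by simp⟩
  have hr0 : Filter.Tendsto (fun ℓ : ℕ => C₀ * (ℓ:ℝ)^(-6:ℝ)) Filter.atTop (nhds 0) := by
    have := ((tendsto_rpow_neg_atTop (show (0:ℝ) < 6 by norm_num)).comp
      (tendsto_natCast_atTop_atTop (R := ℝ))).const_mul C₀
    simpa using this
  have happ : ∀ ε : ℝ, 0 < ε → ∃ ν : Measure ℝ, IsProbabilityMeasure ν ∧ Reg A ν ∧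
      ∀ v : ℝ → ℝ, Measurable v → (∀ x, |v x| ≤ 1) → |∫ x, v x ∂ν - ∫ x, v x ∂μ| ≤ ε := by
    intro ε hε
    obtain ⟨N, hN⟩ := tv_approx μ T hinv hsuppc _ hr0 hdecm (volume.restrict (Ioc (0:ℝ) 1))
      (dens_ac α hα0 h c₁ c₂ hc₁ hdens μ hμ) ε hε
    exact ⟨_, Measure.isProbabilityMeasure_map (hTm.iterate N).aemeasurable,
      reg_push_iter A T hTm hb _ (reg_lebesgue A hA) N, hN⟩
  obtain ⟨Cf, hCf, hdec⟩ := decouple μ T hinv hsupp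
    (dens_int α hα0 hα7 h c₁ c₂ hc₁ hc₁₂ hdens μ hμ) C₀ hC₀ hdecm (8 * (A + 2)) (by positivity)
  -- contraction
  set c : ℝ := min (lam - 1) 1 with hc
  have hc0 : 0 < c := lt_min hl1 one_pos
  have hexp : ∀ x ∈ Icc (0:ℝ) 1, ∀ y ∈ Icc (0:ℝ) 1, SameSide x y →
      |x - y| + c * |x - y| ^ (1 + α) ≤ |T x - T y| := by
    intro x hx y hy hs
    unfold SameSide at hs
    have hd1 : |x - y| ≤ 1 := by
      rw [abs_le]; constructor <;> linarith [hx.1, hx.2, hy.1, hy.2]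
    by_cases hx2 : x < 1/2
    · have hy2 := hs.1 hx2
      have e := TL_expand α hα0 x y hx.1 hy.1
      rw [hT_formula x ⟨hx.1, hx2⟩, hT_formula y ⟨hy.1, hy2⟩]
      unfold TL at e
      refine le_trans ?_ e
      have : c ≤ (2:ℝ)^α := (min_le_right _ _).trans (Real.one_le_rpow (by norm_num) hα0.le)
      gcongr
    · have hy2 : ¬ y < 1/2 := fun hh => hx2 (hs.2 hh)
      refine le_trans ?_ (hr1 x ⟨not_lt.1 hx2, hx.2⟩ y ⟨not_lt.1 hy2, hy.2⟩)
      have h1 : |x - y| ^ (1 + α) ≤ |x - y| := by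
        have := Real.rpow_le_rpow_of_exponent_ge' (abs_nonneg (x - y)) hd1 zero_le_one
          (show (1:ℝ) ≤ 1 + α by linarith)
        simpa using this
      have h2 : c * |x - y| ^ (1 + α) ≤ (lam - 1) * |x - y| :=
        mul_le_mul (min_le_left _ _) h1 (by positivity) hl1.le
      linarith
  obtain ⟨B, hB, hstep⟩ := theta_bound c α hc0 hα0 hα7
  have hcon := contraction_iter T hT_maps B (contraction α c T hT_maps hexp B hB hstep)
  obtain ⟨S, hS0, hS⟩ := aa_sum
  have hB0 : 0 ≤ B := by linarith
  refine ⟨S * ((1024 * B + 64 * Cf + 4) * S * (1 + S)), by positivity, ?_⟩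
  intro n _ K L hK
  have hnn := LLx_nonneg K L hK
  have hKc := K_cont K L hK
  set Q : (ℕ → ℝ) → ℝ := fun z => K (fun i => clamp (z i)) with hQ
  have hQm : Measurable Q := by
    have : Continuous Q := hKc.comp (continuous_pi fun i => clamp_cont.comp (continuous_apply _))
    exact hKc.measurable.comp (measurable_pi_iff.2 fun i =>
      clamp_cont.measurable.comp (measurable_pi_apply _))
  have hQ0 : ∀ j (z zz : ℕ → ℝ), (∀ i, i ≠ j → z i = zz i) →
      |Q z - Q zz| ≤ LLx L j * |clamp (z j) - clamp (zz j)| := fun j z zz hz =>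
    K_lip K L hK j (fun i => clamp (z i)) (fun i => clamp (zz i)) fun i hi => by simp only [hz i hi]
  have hQ1 : ∀ j (z zz : ℕ → ℝ), (∀ i, i ≠ j → z i = zz i) → |Q z - Q zz| ≤ LLx L j * |z j - zz j| :=
    fun j z zz hz => (hQ0 j z zz hz).trans (mul_le_mul_of_nonneg_left (clamp_lip _ _) (hnn j))
  have hQ2 : ∀ j (z zz : ℕ → ℝ), (∀ i, i ≠ j → z i = zz i) → |Q z - Q zz| ≤ LLx L j :=
    fun j z zz hz => (hQ0 j z zz hz).trans
      ((mul_le_mul_of_nonneg_left (clamp_diff _ _) (hnn j)).trans (by rw [mul_one]))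
  have hQ3 : ∀ z zz : ℕ → ℝ, (∀ i < n, z i = zz i) → Q z = Q zz := fun z zz hz => by
    simp only [hQ]
    congr 1
    funext i
    rw [hz i i.2]
  have hbd : ∃ Bd, ∀ z, |Q z| ≤ Bd := by
    obtain ⟨Bd, hBd⟩ := (isCompact_univ_pi (fun _ : Fin n => isCompact_Icc (a := (0:ℝ)) (b := 1))).exists_bound_of_continuousOn
      hKc.continuousOn
    exact ⟨Bd, fun z => hBd _ fun i _ => clamp_mem _⟩
  obtain ⟨Bd, hBd⟩ := hbd
  have hfin := variance_seq μ T hinv Cf hCf.le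
    (fun H M ω J ℓ hHm hHM hω hℓ => main_lemma A hA μ T hinv hsupp hb happ Cf hdec H hHm M ω hHM J hω ℓ hℓ)
    B hB0 hcon S hS0 hS n Q (LLx L) hnn hQm hQ1 hQ2 hQ3 Bd hBd
  rw [LLx_sum] at hfin
  have hae : ∀ᵐ x ∂μ, Q (fun i => T^[i] x) = K (fun i => T^[(i:ℕ)] x) := by
    filter_upwards [hsuppc] with x hx
    simp only [hQ]
    congr 1
    funext i
    exact clamp_of_mem _ (hT_maps.iterate i hx)
  rw [integral_congr_ae hae] at hfin
  calc _ = ∫ x, (Q (fun i => T^[i] x) - ∫ y, K (fun i => T^[(i:ℕ)] y) ∂μ) ^ 2 ∂μ := by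
        refine integral_congr_ae ?_
        filter_upwards [hae] with x hx
        rw [hx]
    _ ≤ _ := hfin.trans (le_of_eq (by ring))

end VarIneq


open MeasureTheory Set

/-- **Variance (Devroye) inequality** for the intermittent interval map
`T x = x + 2^α x^(1+α)` on `[0,1/2)`, expanding on `[1/2,1]`, with invariant
density `h(x) ≍ x^(-α)`, assuming the correlation-decay estimate for
continuous × Lipschitz observables: there is a constant `D = D(α) > 0` such
that for all `n ≥ 1` and all componentwise Lipschitz `K : [0,1]^n → ℝ`,
`∫ (K(x,…,T^{n-1}x) - ∫ K(y,…,T^{n-1}y) dμ(y))² dμ(x) ≤ D ∑_j Lip_j(K)²`. -/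
theorem variance_inequality_intermittent_map
    (α : ℝ) (hα0 : 0 < α) (hα1 : α < 4 - Real.sqrt 15)
    (T : ℝ → ℝ) (hT_maps : MapsTo T (Icc (0:ℝ) 1) (Icc (0:ℝ) 1))
    (hT_formula : ∀ x ∈ Ico (0:ℝ) (1/2), T x = x + (2:ℝ) ^ α * x ^ (1 + α))
    (T' : ℝ → ℝ)
    (hT_deriv : ∀ x ∈ Icc (1/2:ℝ) 1, HasDerivWithinAt T (T' x) (Icc (1/2:ℝ) 1) x)
    (hT_C2 : ContDiffOn ℝ 2 T (Icc (1/2:ℝ) 1))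
    (hT_bij : BijOn T (Icc (1/2:ℝ) 1) (Icc (0:ℝ) 1))
    (hT_expanding : ∀ x ∈ Icc (1/2:ℝ) 1, 1 < |T' x|)
    (h : ℝ → ℝ) (c₁ c₂ : ℝ) (hc₁ : 0 < c₁) (hc₁₂ : c₁ ≤ c₂)
    (hdens : ∀ x ∈ Ioc (0:ℝ) 1, c₁ * x ^ (-α) ≤ h x ∧ h x ≤ c₂ * x ^ (-α))
    (μ : Measure ℝ) (hprob : IsProbabilityMeasure μ)
    (hμ : μ = (volume.restrict (Icc (0:ℝ) 1)).withDensity (fun x => ENNReal.ofReal (h x)))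
    (hinv : MeasurePreserving T μ μ)
    (C₀ : ℝ) (hC₀ : 0 < C₀)
    (hdecay : ∀ (v w : ℝ → ℝ) (Mv : ℝ) (Lw : NNReal),
      ContinuousOn v (Icc (0:ℝ) 1) → (∀ x ∈ Icc (0:ℝ) 1, |v x| ≤ Mv) →
      LipschitzOnWith Lw w (Icc (0:ℝ) 1) →
      ∀ ℓ : ℕ, 1 ≤ ℓ →
        |(∫ x, v (T^[ℓ] x) * w x ∂μ) - (∫ x, v x ∂μ) * (∫ x, w x ∂μ)|
          ≤ C₀ * Mv * (Lw : ℝ) * (ℓ : ℝ) ^ (1 - 1/α)) :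
    ∃ D > (0:ℝ), ∀ n : ℕ, 1 ≤ n → ∀ (K : (Fin n → ℝ) → ℝ) (L : Fin n → ℝ),
      (∀ (j : Fin n) (z zz : Fin n → ℝ), (∀ i, i ≠ j → z i = zz i) →
        |K z - K zz| ≤ L j * |z j - zz j|) →
      ∫ x, (K (fun i => T^[(i:ℕ)] x) - ∫ y, K (fun i => T^[(i:ℕ)] y) ∂μ) ^ 2 ∂μ
        ≤ D * ∑ j, (L j) ^ 2 := by

  exact VarIneq.final α hα0 hα1 T hT_maps hT_formula T' hT_deriv hT_C2 hT_bij hT_expanding h c₁ c₂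
    hc₁ hc₁₂ hdens μ hprob hμ hinv C₀ hC₀ hdecay
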